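/- arXiv:2403.13515 — 7 statements merged into one kernel-verified Lean document; each statement's English description precedes it below -/
import Mathlib

section
/- Let d > 0, c > 0, γ ≠ 0 and α ∈ ℝ. There exists a unique tuple (b̂₀, b₀, b₁, b₂, b₃) ∈ ℝ⁵ such that for every real polynomial p of degree at most 4 one has p'(0) + p'(d) = b̂₀·(α·p(0) - (γ/c)·p'(0)) + (1/d)·(b₀·p(0) + b₁·p(d) + b₂·p(2d) + b₃·p(3d)); this tuple is given by b̂₀ = -2c/(3γ), b₀ = (12αdc - 17γ)/(18γ), b₁ = 1/2, b₂ = 1/2, b₃ = -1/18. -/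
open Polynomial

/-- The stated coefficients make the boundary scheme exact in degree at most four. -/
theorem boundary_scheme_exact {d c γ : ℝ} (α : ℝ) (hd : d ≠ 0) (hc : c ≠ 0) (hγ : γ ≠ 0)
    {p : Polynomial ℝ} (hp : p.degree ≤ 4) :
    p.derivative.eval 0 + p.derivative.eval d =
      (-2 * c / (3 * γ)) * (α * p.eval 0 - (γ / c) * p.derivative.eval 0) +
      (1 / d) * (((12 * α * d * c - 17 * γ) / (18 * γ)) * p.eval 0
        + (1 / 2) * p.eval d + (1 / 2) * p.eval (2 * d) - (1 / 18) * p.eval (3 * d)) := by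
  have hn : p.natDegree < 5 := Nat.lt_succ_of_le (natDegree_le_of_degree_le hp)
  rw [p.as_sum_range' 5 hn]
  simp only [Finset.sum_range_succ, Finset.sum_range_zero, derivative_add, derivative_zero,
    derivative_monomial, eval_add, eval_zero, eval_monomial]
  push_cast
  field_simp
  ring

/-- There is a unique tuple `(b̂₀, b₀, b₁, b₂, b₃)` making the boundary scheme
`p'(0) + p'(d) = b̂₀(α p(0) - (γ/c) p'(0)) + (1/d)(b₀ p(0) + b₁ p(d) + b₂ p(2d) + b₃ p(3d))`
exact on all real polynomials of degree at most 4, and it is given by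
`b̂₀ = -2c/(3γ)`, `b₀ = (12αdc - 17γ)/(18γ)`, `b₁ = 1/2`, `b₂ = 1/2`, `b₃ = -1/18`. -/
theorem boundary_scheme_coefficients_unique (d c γ α : ℝ) (hd : 0 < d) (hc : 0 < c)
    (hγ : γ ≠ 0) :
    (∃! t : ℝ × ℝ × ℝ × ℝ × ℝ,
      ∀ p : Polynomial ℝ, p.degree ≤ 4 →
        p.derivative.eval 0 + p.derivative.eval d =
          t.1 * (α * p.eval 0 - (γ / c) * p.derivative.eval 0) +
          (1 / d) * (t.2.1 * p.eval 0 + t.2.2.1 * p.eval d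
            + t.2.2.2.1 * p.eval (2 * d) + t.2.2.2.2 * p.eval (3 * d))) ∧
    (∀ p : Polynomial ℝ, p.degree ≤ 4 →
      p.derivative.eval 0 + p.derivative.eval d =
        (-2 * c / (3 * γ)) * (α * p.eval 0 - (γ / c) * p.derivative.eval 0) +
        (1 / d) * (((12 * α * d * c - 17 * γ) / (18 * γ)) * p.eval 0
          + (1 / 2) * p.eval d + (1 / 2) * p.eval (2 * d) - (1 / 18) * p.eval (3 * d))) := by
  have hd' : d ≠ 0 := hd.ne'
  have hc' : c ≠ 0 := hc.ne'
  refine ⟨⟨(-2 * c / (3 * γ), (12 * α * d * c - 17 * γ) / (18 * γ), 1 / 2, 1 / 2, -(1 / 18)),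
    fun p hp => ?_, ?_⟩, fun p hp => boundary_scheme_exact α hd' hc' hγ hp⟩
  · rw [boundary_scheme_exact α hd' hc' hγ hp]
    ring
  rintro ⟨s, b₀, b₁, b₂, b₃⟩ h
  have hdeg (k : ℕ) (hk : k ≤ 4) : (X ^ k : Polynomial ℝ).degree ≤ 4 :=
    (degree_X_pow_le k).trans (by exact_mod_cast hk)
  have e₀ := h (X ^ 0) (hdeg 0 (by norm_num))
  have e₁ := h (X ^ 1) (hdeg 1 (by norm_num))
  have e₂ := h (X ^ 2) (hdeg 2 (by norm_num))
  have e₃ := h (X ^ 3) (hdeg 3 (by norm_num))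
  have e₄ := h (X ^ 4) (hdeg 4 (by norm_num))
  simp only [derivative_X_pow, eval_mul, eval_pow, eval_X, eval_C] at e₀ e₁ e₂ e₃ e₄
  norm_num at e₀ e₁ e₂ e₃ e₄
  have m₂ : 2 = b₁ + 4 * b₂ + 9 * b₃ := by
    field_simp at e₂
    linarith
  have m₃ : 3 = b₁ + 8 * b₂ + 27 * b₃ := by
    field_simp at e₃
    linarith
  have m₄ : 4 = b₁ + 16 * b₂ + 81 * b₃ := by
    field_simp at e₄
    linarith
  obtain rfl : b₃ = -(1 / 18) := by linarith
  obtain rfl : b₂ = 1 / 2 := by linarith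
  obtain rfl : b₁ = 1 / 2 := by linarith
  obtain rfl : s = -2 * c / (3 * γ) := by
    field_simp at e₁ ⊢
    linarith
  obtain rfl : b₀ = (12 * α * d * c - 17 * γ) / (18 * γ) := by
    field_simp at e₀ ⊢
    linarith
  rfl
end

section
/- Let T > 0 and let f : [0,T] → ℝ be continuously differentiable. Then the function F(t) = ∫₀ᵗ f(s)/√(t - s) ds is differentiable on (0,T], and for every t ∈ (0,T], F'(t) = f(0)/√t + ∫₀ᵗ f'(s)/√(t - s) ds. -/
open intervalIntegral Set

theorem intervalIntegrable_inv_sqrt_one_sub :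
    IntervalIntegrable (fun u : ℝ => (√(1 - u))⁻¹) MeasureTheory.volume 0 1 := by
  have h : IntervalIntegrable (fun u : ℝ => u ^ (-(1 / 2) : ℝ)) MeasureTheory.volume 0 1 :=
    intervalIntegrable_rpow' (by norm_num)
  have h' := (h.comp_sub_left 1).symm
  simp only [sub_zero, sub_self] at h'
  refine h'.congr ?_
  intro u hu
  rw [uIoc_of_le zero_le_one] at hu
  have : 0 ≤ 1 - u := by linarith [hu.2]
  simp only
  rw [Real.rpow_neg this, ← Real.sqrt_eq_rpow]

theorem intervalIntegrable_div_sqrt_one_sub {φ : ℝ → ℝ} (hφ : Continuous φ) :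
    IntervalIntegrable (fun u : ℝ => φ u / √(1 - u)) MeasureTheory.volume 0 1 := by
  simpa only [div_eq_mul_inv] using
    intervalIntegrable_inv_sqrt_one_sub.continuousOn_mul hφ.continuousOn

/-- Rescaling of the Abel integral to the unit interval. -/
theorem abel_integral_eq_sqrt_mul (φ : ℝ → ℝ) {t : ℝ} (ht : 0 < t) :
    ∫ s in (0 : ℝ)..t, φ s / √(t - s) = √t * ∫ u in (0 : ℝ)..1, φ (t * u) / √(1 - u) := by
  have h := smul_integral_comp_mul_left (a := 0) (b := 1) (fun s => φ s / √(t - s)) t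
  rw [mul_zero, mul_one] at h
  rw [← h, smul_eq_mul, ← integral_const_mul, ← integral_const_mul]
  refine integral_congr fun u _ => ?_
  have hs : √(t - t * u) = √t * √(1 - u) := by
    rw [← Real.sqrt_mul ht.le]; congr 1; ring
  have hne : √t ≠ 0 := (Real.sqrt_pos.2 ht).ne'
  simp only [hs]
  calc t * (φ (t * u) / (√t * √(1 - u)))
      = (√t * √t) * (φ (t * u) / (√t * √(1 - u))) := by rw [Real.mul_self_sqrt ht.le]
    _ = √t * (φ (t * u) / √(1 - u)) := by
      rw [div_mul_eq_div_div]; field_simp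

/-- Integration by parts against the primitive `-2 √(1 - u)` of the Abel kernel. -/
theorem integral_comp_mul_div_sqrt_one_sub {g h : ℝ → ℝ} (hg : ∀ x, HasDerivAt g (h x) x)
    (hh : Continuous h) (t : ℝ) :
    ∫ u in (0 : ℝ)..1, g (t * u) / √(1 - u) =
      2 * g 0 + 2 * t * ∫ u in (0 : ℝ)..1, h (t * u) * √(1 - u) := by
  have hgc : Continuous g := continuous_iff_continuousAt.2 fun x => (hg x).continuousAt
  have hi₁ := intervalIntegrable_div_sqrt_one_sub (φ := fun u => g (t * u)) (by fun_prop)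
  have hi₂ : IntervalIntegrable (fun u => 2 * t * (h (t * u) * √(1 - u)))
      MeasureTheory.volume 0 1 := Continuous.intervalIntegrable (by fun_prop) _ _
  have key := integral_eq_sub_of_hasDerivAt_of_le (zero_le_one' ℝ)
    (f := fun u => -2 * (g (t * u) * √(1 - u)))
    (f' := fun u => g (t * u) / √(1 - u) - 2 * t * (h (t * u) * √(1 - u)))
    (Continuous.continuousOn (by fun_prop)) ?_ (hi₁.sub hi₂)
  · rw [integral_sub hi₁ hi₂, integral_const_mul] at key
    simp only [mul_zero, sub_zero, sub_self, Real.sqrt_zero, Real.sqrt_one, mul_one] at key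
    linarith
  · intro u hu
    have hpos : 0 < 1 - u := by linarith [hu.2]
    have h₁ : HasDerivAt (fun u => g (t * u)) (h (t * u) * (t * 1)) u :=
      (hg (t * u)).comp u ((hasDerivAt_id u).const_mul t)
    have h₂ : HasDerivAt (fun u : ℝ => √(1 - u)) (-1 / (2 * √(1 - u))) u :=
      ((hasDerivAt_id u).const_sub 1).sqrt hpos.ne'
    refine ((h₁.mul h₂).const_mul (-2)).congr_deriv ?_
    have hne : √(1 - u) ≠ 0 := (Real.sqrt_pos.2 hpos).ne'
    field_simp
    ring

/-- Differentiation under the integral sign for the rescaled Abel integral. -/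
theorem hasDerivAt_integral_comp_mul_div_sqrt {g h : ℝ → ℝ} (hg : ∀ x, HasDerivAt g (h x) x)
    (hh : Continuous h) (t : ℝ) :
    HasDerivAt (fun t => ∫ u in (0 : ℝ)..1, g (t * u) / √(1 - u))
      (∫ u in (0 : ℝ)..1, h (t * u) * u / √(1 - u)) t := by
  have hgc : Continuous g := continuous_iff_continuousAt.2 fun x => (hg x).continuousAt
  obtain ⟨C, hC⟩ := (isCompact_Icc (a := -(|t| + 1)) (b := |t| + 1)).exists_bound_of_continuousOn
    hh.continuousOn
  refine (intervalIntegral.hasDerivAt_integral_of_dominated_loc_of_deriv_le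
    (F := fun t u => g (t * u) / √(1 - u)) (F' := fun t u => h (t * u) * u / √(1 - u))
    (bound := fun u => C / √(1 - u)) (Metric.ball_mem_nhds t one_pos) ?_ ?_ ?_ ?_ ?_ ?_).2
  · filter_upwards with x
    exact (intervalIntegrable_div_sqrt_one_sub
      (φ := fun u => g (x * u)) (by fun_prop)).def'.aestronglyMeasurable
  · exact intervalIntegrable_div_sqrt_one_sub (φ := fun u => g (t * u)) (by fun_prop)
  · exact (intervalIntegrable_div_sqrt_one_sub
      (φ := fun u => h (t * u) * u) (by fun_prop)).def'.aestronglyMeasurable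
  · filter_upwards with u hu x hx
    rw [uIoc_of_le zero_le_one] at hu
    have hx' : |x| ≤ |t| + 1 := by
      have h₁ : |x - t| < 1 := by simpa [Real.dist_eq] using hx
      have h₂ := abs_sub_abs_le_abs_sub x t
      linarith
    have hu' : |u| ≤ 1 := abs_le.2 ⟨by linarith [hu.1], hu.2⟩
    have hxu : |x * u| ≤ |t| + 1 := by
      rw [abs_mul]
      exact (mul_le_of_le_one_right (abs_nonneg x) hu').trans hx'
    have hb := hC (x * u) (abs_le.1 hxu)
    rw [norm_div, norm_mul, Real.norm_of_nonneg (Real.sqrt_nonneg _)]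
    gcongr
    exact (mul_le_of_le_one_right (norm_nonneg _) hu').trans hb
  · exact intervalIntegrable_div_sqrt_one_sub continuous_const
  · filter_upwards with u _ x _
    have h₁ : HasDerivAt (fun x => g (x * u)) (h (x * u) * (1 * u)) x :=
      (hg (x * u)).comp x ((hasDerivAt_id x).mul_const u)
    simpa using h₁.div_const (√(1 - u))

theorem hasDerivAt_abel_integral {g h : ℝ → ℝ} (hg : ∀ x, HasDerivAt g (h x) x)
    (hh : Continuous h) {t : ℝ} (ht : 0 < t) :
    HasDerivAt (fun t => ∫ s in (0 : ℝ)..t, g s / √(t - s))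
      (g 0 / √t + ∫ s in (0 : ℝ)..t, h s / √(t - s)) t := by
  have hd := ((hasDerivAt_id t).sqrt ht.ne').mul (hasDerivAt_integral_comp_mul_div_sqrt hg hh t)
  have hev : (fun t => ∫ s in (0 : ℝ)..t, g s / √(t - s)) =ᶠ[nhds t]
      fun t => √t * ∫ u in (0 : ℝ)..1, g (t * u) / √(1 - u) := by
    filter_upwards [lt_mem_nhds ht] with x hx using abel_integral_eq_sqrt_mul g hx
  refine (HasDerivAt.congr_of_eventuallyEq hd hev).congr_deriv ?_
  have hsplit : ∫ u in (0 : ℝ)..1, h (t * u) / √(1 - u) =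
      (∫ u in (0 : ℝ)..1, h (t * u) * u / √(1 - u)) +
        ∫ u in (0 : ℝ)..1, h (t * u) * √(1 - u) := by
    rw [← integral_add (intervalIntegrable_div_sqrt_one_sub (by fun_prop))
      (Continuous.intervalIntegrable (by fun_prop) _ _)]
    refine integral_congr fun u hu => ?_
    rw [uIcc_of_le zero_le_one] at hu
    rcases hu.2.eq_or_lt with rfl | hlt
    · simp
    · have hpos : 0 < 1 - u := by linarith
      have hne : √(1 - u) ≠ 0 := (Real.sqrt_pos.2 hpos).ne'
      field_simp
      rw [Real.sq_sqrt hpos.le]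
      ring
  rw [abel_integral_eq_sqrt_mul h ht, hsplit]
  simp only [id]
  rw [integral_comp_mul_div_sqrt_one_sub hg hh t]
  have hne : √t ≠ 0 := (Real.sqrt_pos.2 ht).ne'
  field_simp
  rw [Real.sq_sqrt ht.le]
  ring

/-- A `C¹` function on `[a, b]` extends to a `C¹` function on the line. -/
theorem ContDiffOn.exists_hasDerivAt_extension {a b : ℝ} (hab : a < b) {f : ℝ → ℝ}
    (hf : ContDiffOn ℝ 1 f (Icc a b)) :
    ∃ g h : ℝ → ℝ, Continuous h ∧ (∀ x, HasDerivAt g (h x) x) ∧ EqOn g f (Icc a b) ∧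
      EqOn h (derivWithin f (Icc a b)) (Icc a b) := by
  have hc : ContinuousOn (derivWithin f (Icc a b)) (Icc a b) :=
    hf.continuousOn_derivWithin (uniqueDiffOn_Icc hab) le_rfl
  set h : ℝ → ℝ := IccExtend hab.le ((Icc a b).domRestrict (derivWithin f (Icc a b)))
  have hh : Continuous h := hc.domRestrict.Icc_extend'
  have heq : EqOn h (derivWithin f (Icc a b)) (Icc a b) := fun x hx =>
    IccExtend_of_mem hab.le _ hx
  refine ⟨fun x => f a + ∫ s in a..x, h s, h, hh, fun x => ?_, fun x hx => ?_, heq⟩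
  · exact (integral_hasDerivAt_right (hh.intervalIntegrable _ _)
      hh.aestronglyMeasurable.stronglyMeasurableAtFilter hh.continuousAt).const_add _
  · have hsub : Icc a x ⊆ Icc a b := Icc_subset_Icc_right hx.2
    have := integral_eq_sub_of_hasDerivAt_of_le hx.1 (hf.continuousOn.mono hsub)
      (f' := h) (fun y hy => ?_) (hh.intervalIntegrable _ _)
    · simp only [this]; ring
    · have hy' : y ∈ Icc a b := hsub (Ioo_subset_Icc_self hy)
      rw [heq hy']
      exact ((hf.differentiableOn one_ne_zero) y hy').hasDerivWithinAt.hasDerivAt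
        (Icc_mem_nhds hy.1 (hy.2.trans_le hx.2))

/-- Leibniz rule for the Abel-type integral with singular kernel `1/√(t-s)`: if `f` is `C¹` on
`[0,T]`, then `F(t) = ∫₀ᵗ f(s)/√(t-s) ds` is differentiable on `(0,T]` with
`F'(t) = f(0)/√t + ∫₀ᵗ f'(s)/√(t-s) ds`. -/
theorem abel_integral_deriv (T : ℝ) (hT : 0 < T) (f : ℝ → ℝ)
    (hf : ContDiffOn ℝ 1 f (Set.Icc 0 T)) :
    ∀ t ∈ Set.Ioc (0 : ℝ) T,
      HasDerivWithinAt (fun t : ℝ => ∫ s in (0 : ℝ)..t, f s / Real.sqrt (t - s))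
        (f 0 / Real.sqrt t
          + ∫ s in (0 : ℝ)..t, derivWithin f (Set.Icc 0 T) s / Real.sqrt (t - s))
        (Set.Ioc 0 T) t := by
  intro t ht
  obtain ⟨g, h, hh, hg, hgf, hhf⟩ := hf.exists_hasDerivAt_extension hT
  have hcongr : ∀ {φ ψ : ℝ → ℝ}, EqOn φ ψ (Icc 0 T) → ∀ x ∈ Ioc 0 T,
      ∫ s in (0 : ℝ)..x, ψ s / √(x - s) = ∫ s in (0 : ℝ)..x, φ s / √(x - s) := by
    intro φ ψ hφψ x hx
    refine integral_congr fun s hs => ?_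
    rw [uIcc_of_le hx.1.le] at hs
    simp only [hφψ (Icc_subset_Icc_right hx.2 hs)]
  rw [hcongr hhf t ht, ← hgf (left_mem_Icc.2 hT.le)]
  exact (hasDerivAt_abel_integral hg hh ht.1).hasDerivWithinAt.congr (hcongr hgf) (hcongr hgf t ht)
end

section
/- Let α > 0 and γ > 0. Then (2/π)·∫₀^∞ γ·k² / ((α - k²)² + (γk)²) dk = 1. -/
open MeasureTheory

open Set Filter Topology

/-- The resonance denominator `(α - k²)² + (γk)²` is positive for `k > 0`. -/
lemma resonance_denom_pos {γ : ℝ} (hγ : 0 < γ) (α : ℝ) {k : ℝ} (hk : 0 < k) :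
    0 < (α - k ^ 2) ^ 2 + (γ * k) ^ 2 := by
  positivity

/-- The inversion `k ↦ α / k` exchanges the two halves of the resonance density. -/
lemma integral_resonance_inversion {α γ : ℝ} (hα : 0 < α) (hγ : 0 < γ) :
    ∫ k in Ioi (0 : ℝ), γ * k ^ 2 / ((α - k ^ 2) ^ 2 + (γ * k) ^ 2) =
      ∫ k in Ioi (0 : ℝ), γ * α / ((α - k ^ 2) ^ 2 + (γ * k) ^ 2) := by
  have himage : (fun k : ℝ => α / k) '' Ioi 0 = Ioi 0 := by
    ext y
    constructor
    · rintro ⟨x, hx, rfl⟩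
      exact div_pos hα hx
    · intro hy
      exact ⟨α / y, div_pos hα hy, div_div_cancel₀ hα.ne'⟩
  have hderiv : ∀ k ∈ Ioi (0 : ℝ),
      HasDerivWithinAt (fun k : ℝ => α / k) (-(α / k ^ 2)) (Ioi 0) k := by
    intro k hk
    have h := ((hasDerivAt_inv (ne_of_gt hk)).const_mul α).hasDerivWithinAt (s := Ioi 0)
    simpa [div_eq_mul_inv] using h
  have hinj : InjOn (fun k : ℝ => α / k) (Ioi 0) := by
    intro x _ y _ hxy
    simpa [div_eq_mul_inv, hα.ne'] using hxy
  have h := integral_image_eq_integral_abs_deriv_smul measurableSet_Ioi hderiv hinj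
    (fun k => γ * k ^ 2 / ((α - k ^ 2) ^ 2 + (γ * k) ^ 2))
  rw [himage] at h
  rw [h]
  refine setIntegral_congr_fun measurableSet_Ioi fun k hk => ?_
  have hk : 0 < k := hk
  have hD := resonance_denom_pos hγ α hk
  have hD' := resonance_denom_pos hγ α (div_pos hα hk)
  simp only [smul_eq_mul]
  rw [abs_neg, abs_of_pos (by positivity), ← mul_div_assoc, div_eq_div_iff hD'.ne' hD.ne']
  field_simp
  ring

/-- The symmetrised resonance density is integrable on `(0, ∞)`, with integral `π`. -/
lemma integrableOn_and_integral_resonance_symm {α γ : ℝ} (hα : 0 < α) (hγ : 0 < γ) :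
    IntegrableOn (fun k : ℝ => γ * (k ^ 2 + α) / ((α - k ^ 2) ^ 2 + (γ * k) ^ 2)) (Ioi 0) ∧
      ∫ k in Ioi (0 : ℝ), γ * (k ^ 2 + α) / ((α - k ^ 2) ^ 2 + (γ * k) ^ 2) = Real.pi := by
  set G : ℝ → ℝ :=
    Function.update (fun k => Real.arctan ((k - α * k⁻¹) / γ)) 0 (-(Real.pi / 2)) with hG
  have hcont : ContinuousWithinAt G (Ici 0) 0 := by
    rw [hG, continuousWithinAt_update_same, Ici_sdiff_left]
    refine (tendsto_nhds_of_tendsto_nhdsWithin Real.tendsto_arctan_atBot).comp ?_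
    refine Tendsto.atBot_div_const hγ ?_
    have hid : Tendsto (fun k : ℝ => k) (𝓝[>] 0) (𝓝 0) := nhdsWithin_le_nhds
    have hinv := tendsto_neg_atTop_atBot.comp
      ((tendsto_inv_nhdsGT_zero (𝕜 := ℝ)).const_mul_atTop hα)
    simpa [sub_eq_add_neg, Function.comp_def] using hid.add_atBot hinv
  have hderiv : ∀ k ∈ Ioi (0 : ℝ),
      HasDerivAt G (γ * (k ^ 2 + α) / ((α - k ^ 2) ^ 2 + (γ * k) ^ 2)) k := by
    intro k hk
    have hk : 0 < k := hk
    have hD := resonance_denom_pos hγ α hk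
    have h := (((hasDerivAt_id k).sub ((hasDerivAt_inv hk.ne').const_mul α)).div_const γ).arctan
    have heq : G =ᶠ[𝓝 k] fun k => Real.arctan ((k - α * k⁻¹) / γ) := by
      filter_upwards [eventually_ne_nhds hk.ne'] with x hx
      simp [hG, hx]
    refine HasDerivAt.congr_of_eventuallyEq ?_ heq
    refine h.congr_deriv ?_
    have hu : 0 < 1 + ((k - α * k⁻¹) / γ) ^ 2 := by positivity
    simp only [Pi.sub_apply, id]
    rw [one_div_mul_eq_div, div_eq_div_iff hu.ne' hD.ne']
    field_simp
    ring
  have hlim : Tendsto G atTop (𝓝 (Real.pi / 2)) := by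
    have h : Tendsto (fun k : ℝ => Real.arctan ((k - α * k⁻¹) / γ)) atTop (𝓝 (Real.pi / 2)) := by
      refine (tendsto_nhds_of_tendsto_nhdsWithin Real.tendsto_arctan_atTop).comp ?_
      refine Tendsto.atTop_div_const hγ ?_
      have hinv := ((tendsto_inv_atTop_zero (𝕜 := ℝ)).const_mul α).neg
      simpa [sub_eq_add_neg] using tendsto_id.atTop_add hinv
    refine h.congr' ?_
    filter_upwards [eventually_ne_atTop 0] with x hx
    simp [hG, hx]
  have hint := integrableOn_Ioi_deriv_of_nonneg hcont hderiv
    (fun k hk => by positivity) hlim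
  refine ⟨hint, ?_⟩
  rw [integral_Ioi_of_hasDerivAt_of_tendsto hcont hderiv hint hlim]
  simp [hG]

/-- For `α, γ > 0`, the integral identity `(2/π)·∫₀^∞ γk²/((α - k²)² + (γk)²) dk = 1` holds. -/
theorem quiescent_velocity_normalization (α γ : ℝ) (hα : 0 < α) (hγ : 0 < γ) :
    (2 / Real.pi) * ∫ k in Set.Ioi (0 : ℝ),
        γ * k ^ 2 / ((α - k ^ 2) ^ 2 + (γ * k) ^ 2) = 1 := by
  obtain ⟨hint, hval⟩ := integrableOn_and_integral_resonance_symm hα hγ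
  have hf : IntegrableOn (fun k : ℝ => γ * k ^ 2 / ((α - k ^ 2) ^ 2 + (γ * k) ^ 2)) (Ioi 0) := by
    refine Integrable.mono' hint (Measurable.aestronglyMeasurable (by fun_prop))
      (Eventually.of_forall fun k => ?_)
    rw [Real.norm_of_nonneg (by positivity)]
    gcongr
    linarith
  have hsub : ∫ k in Ioi (0 : ℝ), γ * α / ((α - k ^ 2) ^ 2 + (γ * k) ^ 2) =
      Real.pi - ∫ k in Ioi (0 : ℝ), γ * k ^ 2 / ((α - k ^ 2) ^ 2 + (γ * k) ^ 2) := by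
    rw [← hval, ← integral_sub hint hf]
    congr 1 with k
    ring
  have hsymm := integral_resonance_inversion hα hγ
  have hhalf : ∫ k in Ioi (0 : ℝ), γ * k ^ 2 / ((α - k ^ 2) ^ 2 + (γ * k) ^ 2) =
      Real.pi / 2 := by
    linarith
  rw [hhalf]
  field_simp
end

section
/- Let α > 0, γ > 0 and u, v₀, y₀ ∈ ℝ, and define y(t) = y₀ + u·t + (2v₀/π)·∫₀^∞ γ·(1 - e^{-k²t})/((α - k²)² + (kγ)²) dk for t ≥ 0. Then y is differentiable on (0,∞) and for every t > 0, y'(t) = u + (2v₀/π)·∫₀^∞ γ·k²·e^{-k²t}/((α - k²)² + (kγ)²) dk. -/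
open MeasureTheory

/-- The resonance denominator is bounded below by a multiple of `(1 + k²)²`. -/
theorem exists_one_add_sq_sq_le_mul_resonance {α γ : ℝ} (hα : 0 < α) (hγ : 0 < γ) :
    ∃ C : ℝ, 0 < C ∧ ∀ k : ℝ, (1 + k ^ 2) ^ 2 ≤ C * ((α - k ^ 2) ^ 2 + (k * γ) ^ 2) := by
  refine ⟨(1 + 1 / α) ^ 2 * (1 + 4 * α / γ ^ 2), by positivity, fun k => ?_⟩
  have h_linear : 1 + k ^ 2 ≤ (1 + 1 / α) * (α + k ^ 2) := by
    have h_expand : (1 + 1 / α) * (α + k ^ 2) = 1 + k ^ 2 + (α + k ^ 2 / α) := by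
      field_simp
      ring
    have h_nonneg : 0 ≤ α + k ^ 2 / α := by positivity
    linarith
  have h_square : (α + k ^ 2) ^ 2 ≤
      (1 + 4 * α / γ ^ 2) * ((α - k ^ 2) ^ 2 + (k * γ) ^ 2) := by
    have h_expand : (1 + 4 * α / γ ^ 2) * ((α - k ^ 2) ^ 2 + (k * γ) ^ 2) =
        (α + k ^ 2) ^ 2 + ((k * γ) ^ 2 + 4 * α / γ ^ 2 * (α - k ^ 2) ^ 2) := by
      field_simp
      ring
    have h_nonneg : 0 ≤ (k * γ) ^ 2 + 4 * α / γ ^ 2 * (α - k ^ 2) ^ 2 := by positivity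
    linarith
  calc (1 + k ^ 2) ^ 2 ≤ ((1 + 1 / α) * (α + k ^ 2)) ^ 2 := by gcongr
    _ = (1 + 1 / α) ^ 2 * (α + k ^ 2) ^ 2 := by ring
    _ ≤ (1 + 1 / α) ^ 2 * ((1 + 4 * α / γ ^ 2) * ((α - k ^ 2) ^ 2 + (k * γ) ^ 2)) := by gcongr
    _ = _ := by ring

/-- A numerator of size at most `γ (1 + k²)` over a denominator dominating `(1 + k²)²`
decays like `(1 + k²)⁻¹`. -/
theorem norm_mul_div_le_mul_inv_one_add_sq {γ C D k a : ℝ} (hγ : 0 < γ) (hC : 0 < C)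
    (hD : (1 + k ^ 2) ^ 2 ≤ C * D) (ha : |a| ≤ 1 + k ^ 2) :
    ‖γ * a / D‖ ≤ γ * C * (1 + k ^ 2)⁻¹ := by
  have hD_pos : 0 < D := pos_of_mul_pos_right (lt_of_lt_of_le (by positivity) hD) hC.le
  rw [Real.norm_eq_abs, abs_div, abs_mul, abs_of_pos hγ, abs_of_pos hD_pos,
    ← div_eq_mul_inv, div_le_div_iff₀ hD_pos (by positivity)]
  calc γ * |a| * (1 + k ^ 2) ≤ γ * (1 + k ^ 2) * (1 + k ^ 2) := by gcongr
    _ = γ * (1 + k ^ 2) ^ 2 := by ring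
    _ ≤ γ * (C * D) := by gcongr
    _ = γ * C * D := by ring

/-- The quiescent-flow solution `y(t) = y₀ + u·t + (2v₀/π)·∫₀^∞ γ(1-e^{-k²t})/((α-k²)²+(kγ)²) dk`
is differentiable on `(0,∞)` with
`y'(t) = u + (2v₀/π)·∫₀^∞ γk²e^{-k²t}/((α-k²)²+(kγ)²) dk`. -/
theorem quiescent_solution_hasDerivAt (α γ u v₀ y₀ : ℝ) (hα : 0 < α) (hγ : 0 < γ) :
    ∀ t : ℝ, 0 < t →
      HasDerivAt
        (fun t : ℝ => y₀ + u * t + (2 * v₀ / Real.pi) *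
          ∫ k in Set.Ioi (0 : ℝ),
            γ * (1 - Real.exp (-k ^ 2 * t)) / ((α - k ^ 2) ^ 2 + (k * γ) ^ 2))
        (u + (2 * v₀ / Real.pi) *
          ∫ k in Set.Ioi (0 : ℝ),
            γ * k ^ 2 * Real.exp (-k ^ 2 * t) / ((α - k ^ 2) ^ 2 + (k * γ) ^ 2))
        t := by
  intro t ht
  obtain ⟨C, hC, h_lower⟩ := exists_one_add_sq_sq_le_mul_resonance hα hγ
  have h_exp_le_one (k : ℝ) {x : ℝ} (hx : 0 < x) : Real.exp (-k ^ 2 * x) ≤ 1 :=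
    Real.exp_le_one_iff.2 (by nlinarith [mul_nonneg (sq_nonneg k) hx.le])
  have h_bound_int : Integrable (fun k : ℝ => γ * C * (1 + k ^ 2)⁻¹)
      (volume.restrict (Set.Ioi 0)) :=
    (integrable_inv_one_add_sq.const_mul _).restrict
  have h_meas (x : ℝ) : AEStronglyMeasurable
      (fun k : ℝ => γ * (1 - Real.exp (-k ^ 2 * x)) / ((α - k ^ 2) ^ 2 + (k * γ) ^ 2))
      (volume.restrict (Set.Ioi 0)) :=
    Measurable.aestronglyMeasurable (by fun_prop)
  have h_integral := (hasDerivAt_integral_of_dominated_loc_of_deriv_le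
    (μ := volume.restrict (Set.Ioi (0 : ℝ)))
    (F := fun x k : ℝ =>
      γ * (1 - Real.exp (-k ^ 2 * x)) / ((α - k ^ 2) ^ 2 + (k * γ) ^ 2))
    (F' := fun x k : ℝ =>
      γ * k ^ 2 * Real.exp (-k ^ 2 * x) / ((α - k ^ 2) ^ 2 + (k * γ) ^ 2))
    (bound := fun k : ℝ => γ * C * (1 + k ^ 2)⁻¹)
    (Ioi_mem_nhds ht) (.of_forall h_meas)
    (h_bound_int.mono' (h_meas t) (.of_forall fun k => ?_))
    (Measurable.aestronglyMeasurable (by fun_prop))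
    (.of_forall fun k x hx => ?_) h_bound_int (.of_forall fun k x _ => ?_)).2
  · have h_linear : HasDerivAt (fun x : ℝ => y₀ + u * x) u t := by
      simpa using ((hasDerivAt_id t).const_mul u).const_add y₀
    exact h_linear.add (h_integral.const_mul (2 * v₀ / Real.pi))
  · refine norm_mul_div_le_mul_inv_one_add_sq hγ hC (h_lower k) ?_
    have h_pos := Real.exp_pos (-k ^ 2 * t)
    rw [abs_of_nonneg (sub_nonneg.2 (h_exp_le_one k ht))]
    nlinarith [sq_nonneg k]
  · rw [mul_assoc γ]
    refine norm_mul_div_le_mul_inv_one_add_sq hγ hC (h_lower k) ?_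
    rw [abs_of_nonneg (by positivity)]
    nlinarith [mul_le_mul_of_nonneg_left (h_exp_le_one k hx) (sq_nonneg k)]
  · have h_exp : HasDerivAt (fun x : ℝ => Real.exp (-k ^ 2 * x))
        (Real.exp (-k ^ 2 * x) * -k ^ 2) x := by
      simpa using ((hasDerivAt_id x).const_mul (-k ^ 2)).exp
    refine (((h_exp.const_sub 1).const_mul γ).div_const _).congr_deriv ?_
    ring
end

section
/- Let α > 0, γ > 0 and u, v₀, y₀ ∈ ℝ, and define y(t) = y₀ + u·t + (2v₀/π)·∫₀^∞ γ·(1 - e^{-k²t})/((α - k²)² + (kγ)²) dk for t ≥ 0. Then as t → ∞, y'(t) → u and y(t) - u·t → y₀ + (2v₀/π)·∫₀^∞ γ/((α - k²)² + (kγ)²) dk; in particular, for a quiescent flow (u = 0) the particle decelerates to a halt and its position converges to a finite limit. -/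
open MeasureTheory Filter

/-- The weight of the relaxation integrals is controlled by `(1 + k²)²`. -/
lemma exists_one_add_sq_sq_le (α γ : ℝ) (hα : 0 < α) (hγ : 0 < γ) :
    ∃ K : ℝ, 0 < K ∧ ∀ k : ℝ,
      (1 + k ^ 2) ^ 2 ≤ K * ((α - k ^ 2) ^ 2 + (k * γ) ^ 2) := by
  refine ⟨(1 + 1 / α) ^ 2 * (1 + 4 * α / γ ^ 2), by positivity, fun k => ?_⟩
  have h₁ : 1 + k ^ 2 ≤ (1 + 1 / α) * (α + k ^ 2) := by
    have h : (1 + 1 / α) * (α + k ^ 2) = 1 + k ^ 2 + (α + k ^ 2 / α) := by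
      field_simp
      ring
    have : 0 ≤ α + k ^ 2 / α := by positivity
    linarith
  have h₂ : (α + k ^ 2) ^ 2 ≤ (1 + 4 * α / γ ^ 2) * ((α - k ^ 2) ^ 2 + (k * γ) ^ 2) := by
    have h : (1 + 4 * α / γ ^ 2) * ((α - k ^ 2) ^ 2 + (k * γ) ^ 2) =
        (α + k ^ 2) ^ 2 + (4 * α / γ ^ 2 * (α - k ^ 2) ^ 2 + (k * γ) ^ 2) := by
      field_simp
      ring
    have : 0 ≤ 4 * α / γ ^ 2 * (α - k ^ 2) ^ 2 + (k * γ) ^ 2 := by positivity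
    linarith
  calc (1 + k ^ 2) ^ 2 ≤ ((1 + 1 / α) * (α + k ^ 2)) ^ 2 := by gcongr
    _ = (1 + 1 / α) ^ 2 * (α + k ^ 2) ^ 2 := by ring
    _ ≤ (1 + 1 / α) ^ 2 * ((1 + 4 * α / γ ^ 2) * ((α - k ^ 2) ^ 2 + (k * γ) ^ 2)) := by gcongr
    _ = _ := by ring

/-- A numerator of at most quadratic growth is integrable against the relaxation weight. -/
lemma integrable_div_relaxation_weight (α γ : ℝ) (hα : 0 < α) (hγ : 0 < γ) {p : ℝ → ℝ}
    (hp : Measurable p) {C : ℝ} (hC : ∀ k, |p k| ≤ C * (1 + k ^ 2)) :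
    Integrable (fun k : ℝ => p k / ((α - k ^ 2) ^ 2 + (k * γ) ^ 2)) := by
  obtain ⟨K, hK, hle⟩ := exists_one_add_sq_sq_le α γ hα hγ
  refine (integrable_inv_one_add_sq.const_mul (C * K)).mono'
    (Measurable.aestronglyMeasurable (by fun_prop)) (Eventually.of_forall fun k => ?_)
  have hs : 0 < 1 + k ^ 2 := by positivity
  have hD : 0 < (α - k ^ 2) ^ 2 + (k * γ) ^ 2 :=
    pos_of_mul_pos_right ((pow_pos hs 2).trans_le (hle k)) hK.le
  have hC0 : 0 ≤ C := nonneg_of_mul_nonneg_left ((abs_nonneg _).trans (hC k)) hs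
  rw [Real.norm_eq_abs, abs_div, abs_of_pos hD, div_le_iff₀ hD, ← div_eq_mul_inv, div_mul_eq_mul_div,
    le_div_iff₀ hs]
  calc |p k| * (1 + k ^ 2) ≤ C * (1 + k ^ 2) * (1 + k ^ 2) := by gcongr; exact hC k
    _ = C * (1 + k ^ 2) ^ 2 := by ring
    _ ≤ C * (K * ((α - k ^ 2) ^ 2 + (k * γ) ^ 2)) := by gcongr; exact hle k
    _ = _ := by ring

lemma exp_neg_sq_mul_le_one (k : ℝ) {t : ℝ} (ht : 0 ≤ t) : Real.exp (-k ^ 2 * t) ≤ 1 :=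
  Real.exp_le_one_iff.2 (mul_nonpos_of_nonpos_of_nonneg (neg_nonpos.2 (sq_nonneg k)) ht)

lemma norm_mul_exp_neg_sq_mul_le (x k : ℝ) {t : ℝ} (ht : 0 ≤ t) :
    ‖x * Real.exp (-k ^ 2 * t)‖ ≤ ‖x‖ := by
  rw [norm_mul, Real.norm_of_nonneg (Real.exp_pos _).le]
  exact mul_le_of_le_one_right (norm_nonneg x) (exp_neg_sq_mul_le_one k ht)

lemma MeasureTheory.Integrable.mul_exp_neg_sq_mul {μ : Measure ℝ} {g : ℝ → ℝ}
    (hg : Integrable g μ) {t : ℝ} (ht : 0 ≤ t) :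
    Integrable (fun k => g k * Real.exp (-k ^ 2 * t)) μ :=
  hg.norm.mono' (hg.aestronglyMeasurable.mul (by fun_prop))
    (Eventually.of_forall fun k => norm_mul_exp_neg_sq_mul_le _ k ht)

lemma tendsto_integral_mul_exp_neg_sq_mul {g : ℝ → ℝ}
    (hg : IntegrableOn g (Set.Ioi 0)) :
    Tendsto (fun t : ℝ => ∫ k in Set.Ioi (0 : ℝ), g k * Real.exp (-k ^ 2 * t))
      atTop (nhds 0) := by
  suffices h : Tendsto (fun t : ℝ => ∫ k in Set.Ioi (0 : ℝ), g k * Real.exp (-k ^ 2 * t))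
      atTop (nhds (∫ _ in Set.Ioi (0 : ℝ), (0 : ℝ))) by
    rwa [integral_zero] at h
  refine tendsto_integral_filter_of_dominated_convergence (fun k => ‖g k‖)
    (Eventually.of_forall fun t => ?_) ?_ hg.norm ?_
  · exact hg.aestronglyMeasurable.mul (by fun_prop)
  · filter_upwards [eventually_ge_atTop 0] with t ht
    exact Eventually.of_forall fun k => norm_mul_exp_neg_sq_mul_le _ k ht
  · filter_upwards [ae_restrict_mem measurableSet_Ioi] with k (hk : 0 < k)
    have h : Tendsto (fun t : ℝ => -k ^ 2 * t) atTop atBot :=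
      tendsto_id.const_mul_atTop_of_neg (neg_lt_zero.2 (pow_pos hk 2))
    simpa using (Real.tendsto_exp_atBot.comp h).const_mul (g k)

lemma hasDerivAt_integral_mul_one_sub_exp {μ : Measure ℝ} {g : ℝ → ℝ} (hg : Integrable g μ)
    (hg' : Integrable (fun k => g k * k ^ 2) μ) {t : ℝ} (ht : 0 < t) :
    HasDerivAt (fun t : ℝ => ∫ k, g k * (1 - Real.exp (-k ^ 2 * t)) ∂μ)
      (∫ k, g k * k ^ 2 * Real.exp (-k ^ 2 * t) ∂μ) t := by
  refine (hasDerivAt_integral_of_dominated_loc_of_deriv_le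
    (F := fun t k => g k * (1 - Real.exp (-k ^ 2 * t)))
    (F' := fun t k => g k * k ^ 2 * Real.exp (-k ^ 2 * t)) (bound := fun k => ‖g k * k ^ 2‖)
    (Ioi_mem_nhds ht) (Eventually.of_forall fun s => hg.aestronglyMeasurable.mul (by fun_prop))
    ?_ (hg'.aestronglyMeasurable.mul (by fun_prop)) ?_ hg'.norm ?_).2
  · simpa only [mul_sub, mul_one] using! hg.sub (hg.mul_exp_neg_sq_mul ht.le)
  · exact Eventually.of_forall fun k s hs => norm_mul_exp_neg_sq_mul_le _ k (le_of_lt hs)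
  · refine Eventually.of_forall fun k s _ => ?_
    have h := ((((hasDerivAt_id' s).const_mul (-k ^ 2)).exp).const_sub 1).const_mul (g k)
    exact h.congr_deriv (by ring)

/-- For the quiescent-flow solution
`y(t) = y₀ + u·t + (2v₀/π)·∫₀^∞ γ(1-e^{-k²t})/((α-k²)²+(kγ)²) dk`,
as `t → ∞` the velocity `y'(t)` tends to `u` and `y(t) - u·t` tends to
`y₀ + (2v₀/π)·∫₀^∞ γ/((α-k²)²+(kγ)²) dk`. -/
theorem quiescent_solution_longtime (α γ u v₀ y₀ : ℝ) (hα : 0 < α) (hγ : 0 < γ) :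
    Tendsto
      (fun t : ℝ => deriv
        (fun t : ℝ => y₀ + u * t + (2 * v₀ / Real.pi) *
          ∫ k in Set.Ioi (0 : ℝ),
            γ * (1 - Real.exp (-k ^ 2 * t)) / ((α - k ^ 2) ^ 2 + (k * γ) ^ 2)) t)
      atTop (nhds u) ∧
    Tendsto
      (fun t : ℝ => (y₀ + u * t + (2 * v₀ / Real.pi) *
          ∫ k in Set.Ioi (0 : ℝ),
            γ * (1 - Real.exp (-k ^ 2 * t)) / ((α - k ^ 2) ^ 2 + (k * γ) ^ 2)) - u * t)
      atTop
      (nhds (y₀ + (2 * v₀ / Real.pi) *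
        ∫ k in Set.Ioi (0 : ℝ), γ / ((α - k ^ 2) ^ 2 + (k * γ) ^ 2))) := by
  have hg : Integrable (fun k : ℝ => γ / ((α - k ^ 2) ^ 2 + (k * γ) ^ 2)) :=
    integrable_div_relaxation_weight α γ hα hγ measurable_const (C := γ) fun k => by
      rw [abs_of_pos hγ]
      nlinarith [mul_nonneg hγ.le (sq_nonneg k)]
  have hg' : Integrable (fun k : ℝ => γ / ((α - k ^ 2) ^ 2 + (k * γ) ^ 2) * k ^ 2) := by
    simp only [div_mul_eq_mul_div]
    refine integrable_div_relaxation_weight α γ hα hγ (by fun_prop) (C := γ) fun k => ?_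
    rw [abs_of_nonneg (by positivity)]
    nlinarith
  simp only [mul_div_right_comm γ]
  constructor
  · have h := ((tendsto_integral_mul_exp_neg_sq_mul hg'.integrableOn).const_mul
      (2 * v₀ / Real.pi)).const_add u
    rw [mul_zero, add_zero] at h
    refine h.congr' ?_
    filter_upwards [eventually_gt_atTop 0] with t ht
    have hlin : HasDerivAt (fun t : ℝ => y₀ + u * t) u t := by
      simpa using ((hasDerivAt_id t).const_mul u).const_add y₀
    exact (hlin.add ((hasDerivAt_integral_mul_one_sub_exp hg.integrableOn
      hg'.integrableOn ht).const_mul (2 * v₀ / Real.pi))).deriv.symm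
  · have h := (((tendsto_integral_mul_exp_neg_sq_mul hg.integrableOn).const_sub
      (∫ k in Set.Ioi (0 : ℝ), γ / ((α - k ^ 2) ^ 2 + (k * γ) ^ 2))).const_mul
      (2 * v₀ / Real.pi)).const_add y₀
    rw [sub_zero] at h
    refine h.congr' ?_
    filter_upwards [eventually_ge_atTop 0] with t ht
    simp only [mul_sub, mul_one]
    rw [integral_sub hg.integrableOn (hg.integrableOn.mul_exp_neg_sq_mul ht)]
    ring
end

section
/- Let α > 0, γ > 0 and u, v₀, y₀ ∈ ℝ, and define y(t) = y₀ + u·t + (2v₀/π)·∫₀^∞ γ·(1 - e^{-k²t})/((α - k²)² + (kγ)²) dk for t ≥ 0. Then the limit of the velocity at the initial time recovers the prescribed initial velocity: y'(t) → u + v₀ as t → 0⁺. -/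
open MeasureTheory Filter

namespace QuiescentRelaxation

open Set Topology

/-- The denominator of the relaxation kernel is positive. -/
lemma denom_pos {α γ k : ℝ} (hγ : 0 < γ) (hk : 0 < k) :
    0 < (α - k ^ 2) ^ 2 + (k * γ) ^ 2 := by
  positivity

lemma hasDerivAt_arctan_sub_div {α γ k : ℝ} (hγ : 0 < γ) (hk : 0 < k) :
    HasDerivAt (fun k : ℝ => Real.arctan ((k - α * k⁻¹) / γ))
      (γ * (k ^ 2 + α) / ((α - k ^ 2) ^ 2 + (k * γ) ^ 2)) k := by
  have hD := denom_pos (α := α) hγ hk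
  have h := ((((hasDerivAt_id k).sub ((hasDerivAt_inv hk.ne').const_mul α)).div_const γ).arctan)
  refine h.congr_deriv ?_
  have hE : 0 < 1 + ((k - α * k⁻¹) / γ) ^ 2 := by positivity
  have hkey : (1 + ((k - α * k⁻¹) / γ) ^ 2) * (k * γ) ^ 2
      = (α - k ^ 2) ^ 2 + (k * γ) ^ 2 := by
    field_simp
    ring
  simp only [id, Pi.sub_apply]
  rw [← hkey]
  field_simp
  ring

lemma tendsto_arctan_sub_div_zero {α γ : ℝ} (hα : 0 < α) (hγ : 0 < γ) :
    Tendsto (fun k : ℝ => Real.arctan ((k - α * k⁻¹) / γ)) (𝓝[>] 0) (𝓝 (-(Real.pi / 2))) := by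
  have hlim : Tendsto (fun k : ℝ => (k - α * k⁻¹) / γ) (𝓝[>] 0) atBot := by
    refine Tendsto.atBot_div_const hγ ?_
    simp_rw [sub_eq_add_neg]
    exact (tendsto_nhdsWithin_of_tendsto_nhds tendsto_id).add_atBot
      (tendsto_neg_atTop_atBot.comp (tendsto_inv_nhdsGT_zero.const_mul_atTop hα))
  exact (Real.tendsto_arctan_atBot.mono_right nhdsWithin_le_nhds).comp hlim

lemma tendsto_arctan_sub_div_atTop {α γ : ℝ} (hγ : 0 < γ) :
    Tendsto (fun k : ℝ => Real.arctan ((k - α * k⁻¹) / γ)) atTop (𝓝 (Real.pi / 2)) := by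
  have hlim : Tendsto (fun k : ℝ => (k - α * k⁻¹) / γ) atTop atTop := by
    refine Tendsto.atTop_div_const hγ ?_
    simp_rw [sub_eq_add_neg]
    exact tendsto_id.atTop_add (tendsto_inv_atTop_zero.const_mul α).neg
  exact (Real.tendsto_arctan_atTop.mono_right nhdsWithin_le_nhds).comp hlim

lemma integrableOn_and_integral_sum {α γ : ℝ} (hα : 0 < α) (hγ : 0 < γ) :
    IntegrableOn (fun k : ℝ => γ * (k ^ 2 + α) / ((α - k ^ 2) ^ 2 + (k * γ) ^ 2)) (Ioi 0) ∧
    ∫ k in Ioi (0 : ℝ), γ * (k ^ 2 + α) / ((α - k ^ 2) ^ 2 + (k * γ) ^ 2) = Real.pi := by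
  set f : ℝ → ℝ := fun k => Real.arctan ((k - α * k⁻¹) / γ)
  set g : ℝ → ℝ := Function.update f 0 (-(Real.pi / 2)) with hg
  have hcont : ContinuousWithinAt g (Ici 0) 0 := by
    rw [hg, continuousWithinAt_update_same, Ici_sdiff_left]
    exact tendsto_arctan_sub_div_zero hα hγ
  have hderiv : ∀ k ∈ Ioi (0 : ℝ), HasDerivAt g
      (γ * (k ^ 2 + α) / ((α - k ^ 2) ^ 2 + (k * γ) ^ 2)) k := fun k hk =>
    (hasDerivAt_arctan_sub_div hγ hk).congr_of_eventuallyEq <| by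
      filter_upwards [eventually_ne_nhds (ne_of_gt hk)] with x hx
      exact Function.update_of_ne hx _ _
  have hnonneg : ∀ k ∈ Ioi (0 : ℝ),
      0 ≤ γ * (k ^ 2 + α) / ((α - k ^ 2) ^ 2 + (k * γ) ^ 2) := fun k _ => by positivity
  have hlim : Tendsto g atTop (𝓝 (Real.pi / 2)) :=
    (tendsto_arctan_sub_div_atTop (α := α) hγ).congr' <| by
      filter_upwards [eventually_ne_atTop 0] with x hx
      exact (Function.update_of_ne hx _ f).symm
  refine ⟨integrableOn_Ioi_deriv_of_nonneg hcont hderiv hnonneg hlim, ?_⟩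
  rw [integral_Ioi_of_hasDerivAt_of_nonneg hcont hderiv hnonneg hlim, hg, Function.update_self]
  ring

lemma integrableOn_sq {α γ : ℝ} (hα : 0 < α) (hγ : 0 < γ) :
    IntegrableOn (fun k : ℝ => γ * k ^ 2 / ((α - k ^ 2) ^ 2 + (k * γ) ^ 2)) (Ioi 0) := by
  refine (integrableOn_and_integral_sum hα hγ).1.mono'
    (by fun_prop : Measurable _).aestronglyMeasurable (ae_of_all _ fun k => ?_)
  rw [Real.norm_of_nonneg (by positivity)]
  gcongr
  linarith

lemma integrableOn_const {α γ : ℝ} (hα : 0 < α) (hγ : 0 < γ) :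
    IntegrableOn (fun k : ℝ => γ * α / ((α - k ^ 2) ^ 2 + (k * γ) ^ 2)) (Ioi 0) := by
  refine (integrableOn_and_integral_sum hα hγ).1.mono'
    (by fun_prop : Measurable _).aestronglyMeasurable (ae_of_all _ fun k => ?_)
  rw [Real.norm_of_nonneg (by positivity)]
  gcongr
  linarith [sq_nonneg k]

/-- The substitution `k ↦ α / k` exchanges the two halves of the integral. -/
lemma integral_sq_eq_integral_const {α γ : ℝ} (hα : 0 < α) (hγ : 0 < γ) :
    ∫ k in Ioi (0 : ℝ), γ * k ^ 2 / ((α - k ^ 2) ^ 2 + (k * γ) ^ 2) =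
      ∫ k in Ioi (0 : ℝ), γ * α / ((α - k ^ 2) ^ 2 + (k * γ) ^ 2) := by
  have himage : (fun k : ℝ => α * k⁻¹) '' Ioi 0 = Ioi 0 := by
    ext x
    constructor
    · rintro ⟨k, hk, rfl⟩
      exact mul_pos hα (inv_pos.2 hk)
    · intro hx
      have hx' : (0 : ℝ) < x := hx
      exact ⟨α * x⁻¹, mul_pos hα (inv_pos.2 hx), by field_simp⟩
  have hinj : InjOn (fun k : ℝ => α * k⁻¹) (Ioi 0) := fun x _ y _ h =>
    inv_injective (mul_left_cancel₀ hα.ne' h)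
  have hsubst := integral_image_eq_integral_abs_deriv_smul measurableSet_Ioi
    (fun k (hk : k ∈ Ioi (0 : ℝ)) =>
      ((hasDerivAt_inv (ne_of_gt hk)).const_mul α).hasDerivWithinAt) hinj
    (fun k : ℝ => γ * k ^ 2 / ((α - k ^ 2) ^ 2 + (k * γ) ^ 2))
  rw [himage] at hsubst
  rw [hsubst]
  refine setIntegral_congr_fun measurableSet_Ioi fun k hk => ?_
  have hk' : 0 < k := hk
  have hD := denom_pos (α := α) hγ hk'
  have hkey : (α - (α * k⁻¹) ^ 2) ^ 2 + (α * k⁻¹ * γ) ^ 2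
      = α ^ 2 / k ^ 4 * ((α - k ^ 2) ^ 2 + (k * γ) ^ 2) := by
    field_simp
    ring
  have habs : |α * -(k ^ 2)⁻¹| = α * (k ^ 2)⁻¹ := by
    rw [mul_neg, abs_neg, abs_of_pos (by positivity)]
  simp only [smul_eq_mul]
  rw [habs, hkey]
  field_simp

lemma integral_sq {α γ : ℝ} (hα : 0 < α) (hγ : 0 < γ) :
    ∫ k in Ioi (0 : ℝ), γ * k ^ 2 / ((α - k ^ 2) ^ 2 + (k * γ) ^ 2) = Real.pi / 2 := by
  have hsum := (integrableOn_and_integral_sum hα hγ).2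
  simp_rw [mul_add, add_div] at hsum
  rw [integral_add (integrableOn_sq hα hγ) (integrableOn_const hα hγ),
    ← integral_sq_eq_integral_const hα hγ] at hsum
  linarith

lemma norm_sq_mul_exp_le {α γ k t : ℝ} (hγ : 0 < γ) (ht : 0 < t) :
    ‖γ * (k ^ 2 * Real.exp (-k ^ 2 * t)) / ((α - k ^ 2) ^ 2 + (k * γ) ^ 2)‖ ≤
      γ * k ^ 2 / ((α - k ^ 2) ^ 2 + (k * γ) ^ 2) := by
  rw [Real.norm_of_nonneg (by positivity)]
  have hexp : Real.exp (-k ^ 2 * t) ≤ 1 :=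
    Real.exp_le_one_iff.2 (by nlinarith [mul_nonneg (sq_nonneg k) ht.le])
  gcongr
  exact mul_le_of_le_one_right (sq_nonneg k) hexp

/-- Differentiation under the integral sign for positive times. -/
lemma hasDerivAt_integral {α γ t : ℝ} (hα : 0 < α) (hγ : 0 < γ) (ht : 0 < t) :
    HasDerivAt (fun t : ℝ => ∫ k in Ioi (0 : ℝ),
        γ * (1 - Real.exp (-k ^ 2 * t)) / ((α - k ^ 2) ^ 2 + (k * γ) ^ 2))
      (∫ k in Ioi (0 : ℝ),
        γ * (k ^ 2 * Real.exp (-k ^ 2 * t)) / ((α - k ^ 2) ^ 2 + (k * γ) ^ 2)) t := by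
  refine (hasDerivAt_integral_of_dominated_loc_of_deriv_le
    (F := fun t k => γ * (1 - Real.exp (-k ^ 2 * t)) / ((α - k ^ 2) ^ 2 + (k * γ) ^ 2))
    (F' := fun t k => γ * (k ^ 2 * Real.exp (-k ^ 2 * t)) / ((α - k ^ 2) ^ 2 + (k * γ) ^ 2))
    (bound := fun k => γ * k ^ 2 / ((α - k ^ 2) ^ 2 + (k * γ) ^ 2))
    (Ioi_mem_nhds ht)
    (Eventually.of_forall fun s => (by fun_prop : Measurable _).aestronglyMeasurable) ?_
    (by fun_prop : Measurable _).aestronglyMeasurable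
    (ae_of_all _ fun k s hs => norm_sq_mul_exp_le hγ hs) (integrableOn_sq hα hγ)
    (ae_of_all _ fun k s _ => ?_)).2
  · refine ((integrableOn_const hα hγ).const_mul α⁻¹).mono'
      (by fun_prop : Measurable _).aestronglyMeasurable (ae_of_all _ fun k => ?_)
    have hexp : Real.exp (-k ^ 2 * t) ≤ 1 :=
      Real.exp_le_one_iff.2 (by nlinarith [mul_nonneg (sq_nonneg k) ht.le])
    have hexp' := Real.exp_pos (-k ^ 2 * t)
    have hnum : 0 ≤ 1 - Real.exp (-k ^ 2 * t) := by linarith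
    rw [Real.norm_of_nonneg (by positivity), ← mul_div_assoc, mul_comm γ α,
      inv_mul_cancel_left₀ hα.ne']
    gcongr
    nlinarith
  · have h := (((((hasDerivAt_id s).const_mul (-k ^ 2)).exp.const_sub 1).const_mul γ).div_const
      ((α - k ^ 2) ^ 2 + (k * γ) ^ 2))
    refine h.congr_deriv ?_
    simp only [id]
    ring

lemma tendsto_integral_sq_mul_exp {α γ : ℝ} (hα : 0 < α) (hγ : 0 < γ) :
    Tendsto (fun t : ℝ => ∫ k in Ioi (0 : ℝ),
        γ * (k ^ 2 * Real.exp (-k ^ 2 * t)) / ((α - k ^ 2) ^ 2 + (k * γ) ^ 2))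
      (𝓝[>] 0) (𝓝 (Real.pi / 2)) := by
  rw [← integral_sq hα hγ]
  refine tendsto_integral_filter_of_dominated_convergence _
    (Eventually.of_forall fun t => (by fun_prop : Measurable _).aestronglyMeasurable) ?_
    (integrableOn_sq hα hγ) (ae_of_all _ fun k => ?_)
  · filter_upwards [self_mem_nhdsWithin] with t ht
    exact ae_of_all _ fun k => norm_sq_mul_exp_le hγ ht
  · have hcont : Continuous fun t : ℝ =>
        γ * (k ^ 2 * Real.exp (-k ^ 2 * t)) / ((α - k ^ 2) ^ 2 + (k * γ) ^ 2) := by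
      fun_prop
    simpa using (hcont.tendsto 0).mono_left nhdsWithin_le_nhds

end QuiescentRelaxation

/-- For the quiescent-flow solution
`y(t) = y₀ + u·t + (2v₀/π)·∫₀^∞ γ(1-e^{-k²t})/((α-k²)²+(kγ)²) dk`,
the velocity recovers the prescribed initial velocity: `y'(t) → u + v₀` as `t → 0⁺`. -/
theorem quiescent_solution_initial_velocity (α γ u v₀ y₀ : ℝ) (hα : 0 < α) (hγ : 0 < γ) :
    Tendsto
      (fun t : ℝ => deriv
        (fun t : ℝ => y₀ + u * t + (2 * v₀ / Real.pi) *
          ∫ k in Set.Ioi (0 : ℝ),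
            γ * (1 - Real.exp (-k ^ 2 * t)) / ((α - k ^ 2) ^ 2 + (k * γ) ^ 2)) t)
      (nhdsWithin 0 (Set.Ioi 0)) (nhds (u + v₀)) := by
  have hlim := ((QuiescentRelaxation.tendsto_integral_sq_mul_exp hα hγ).const_mul
    (2 * v₀ / Real.pi)).const_add u
  have hval : u + 2 * v₀ / Real.pi * (Real.pi / 2) = u + v₀ := by
    field_simp
  rw [hval] at hlim
  refine hlim.congr' ?_
  filter_upwards [self_mem_nhdsWithin] with t ht
  have hlin : HasDerivAt (fun t : ℝ => y₀ + u * t) u t := by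
    simpa using ((hasDerivAt_id t).const_mul u).const_add y₀
  exact (hlin.add ((QuiescentRelaxation.hasDerivAt_integral hα hγ ht).const_mul
    (2 * v₀ / Real.pi))).deriv.symm
end

section
/- Let T > 0 and let h : [0,T] → ℝ be continuously differentiable. Suppose q : [0,∞) × [0,T] → ℝ is bounded, continuous on ((0,∞) × [0,T]) ∪ ({0} × (0,T]), smooth on (0,∞) × (0,T] where it satisfies the heat equation ∂ₜq = ∂ₓₓq, satisfies q(x,0) = 0 for all x > 0, and q(0,t) = h(t) for t ∈ (0,T]. Then for every t ∈ (0,T] the one-sided spatial derivative ∂ₓq(0,t) exists and equals -(1/√π)·( h(0)/√t + ∫₀ᵗ h'(s)/√(t-s) ds ). -/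
open MeasureTheory Filter intervalIntegral
open Set Topology

/-- The Gauss error function `(2/√π) ∫₀ʸ exp(-u²) du`. -/
noncomputable def gaussErf (y : ℝ) : ℝ :=
  2 / √Real.pi * ∫ u in (0 : ℝ)..y, Real.exp (-u ^ 2)

/-- The unnormalised heat kernel `s^{-1/2} exp(-x²/(4s))`, which vanishes for `s ≤ 0`. -/
noncomputable def heatGauss (x s : ℝ) : ℝ := (√s)⁻¹ * Real.exp (-x ^ 2 / (4 * s))

/-- The half-line solution of the heat equation with zero initial and unit boundary data. -/
noncomputable def heatErfc (x s : ℝ) : ℝ := if 0 < s then 1 - gaussErf (x / (2 * √s)) else 0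

/-- The half-line Poisson kernel of the heat equation: the time derivative of `heatErfc`. -/
noncomputable def heatPoisson (x s : ℝ) : ℝ := (√Real.pi)⁻¹ * (x / (2 * s) * heatGauss x s)

lemma hasDerivAt_gaussErf (y : ℝ) :
    HasDerivAt gaussErf (2 / √Real.pi * Real.exp (-y ^ 2)) y := by
  have hc : Continuous fun u : ℝ => Real.exp (-u ^ 2) := by fun_prop
  exact (hc.integral_hasStrictDerivAt 0 y).hasDerivAt.const_mul _

lemma continuous_gaussErf : Continuous gaussErf :=
  continuous_iff_continuousAt.2 fun y => (hasDerivAt_gaussErf y).continuousAt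

lemma gaussErf_zero : gaussErf 0 = 0 := by simp [gaussErf]

lemma gaussErf_neg (y : ℝ) : gaussErf (-y) = -gaussErf y := by
  have := intervalIntegral.integral_comp_neg (a := 0) (b := y) fun u : ℝ => Real.exp (-u ^ 2)
  simp only [neg_sq, neg_zero] at this
  rw [gaussErf, gaussErf, this, intervalIntegral.integral_symm]
  ring

lemma monotone_gaussErf : Monotone gaussErf :=
  monotone_of_deriv_nonneg (fun y => (hasDerivAt_gaussErf y).differentiableAt) fun y => by
    rw [(hasDerivAt_gaussErf y).deriv]; positivity

lemma tendsto_gaussErf_atTop : Tendsto gaussErf atTop (𝓝 1) := by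
  have hi : IntegrableOn (fun u : ℝ => Real.exp (-u ^ 2)) (Ioi 0) := by
    simpa using (integrable_exp_neg_mul_sq (b := 1) one_pos).integrableOn (s := Ioi 0)
  have h := (intervalIntegral_tendsto_integral_Ioi 0 hi tendsto_id).const_mul (2 / √Real.pi)
  have hv : ∫ u in Ioi (0 : ℝ), Real.exp (-u ^ 2) = √Real.pi / 2 := by
    simpa using integral_gaussian_Ioi 1
  rw [hv] at h
  have hp : √Real.pi ≠ 0 := by positivity
  convert! h using 2
  field_simp

lemma gaussErf_le_one (y : ℝ) : gaussErf y ≤ 1 :=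
  monotone_gaussErf.ge_of_tendsto tendsto_gaussErf_atTop y

lemma neg_one_le_gaussErf (y : ℝ) : -1 ≤ gaussErf y := by
  have := gaussErf_le_one (-y)
  rw [gaussErf_neg] at this
  linarith

lemma heatGauss_of_nonpos {s : ℝ} (hs : s ≤ 0) (x : ℝ) : heatGauss x s = 0 := by
  simp [heatGauss, Real.sqrt_eq_zero_of_nonpos hs]

lemma heatErfc_of_nonpos {s : ℝ} (hs : s ≤ 0) (x : ℝ) : heatErfc x s = 0 := by
  simp [heatErfc, not_lt.2 hs]

lemma heatErfc_of_pos {s : ℝ} (hs : 0 < s) (x : ℝ) :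
    heatErfc x s = 1 - gaussErf (x / (2 * √s)) := by
  simp [heatErfc, hs]

lemma heatPoisson_of_nonpos {s : ℝ} (hs : s ≤ 0) (x : ℝ) : heatPoisson x s = 0 := by
  simp [heatPoisson, heatGauss_of_nonpos hs]

lemma heatErfc_nonneg (x s : ℝ) : 0 ≤ heatErfc x s := by
  unfold heatErfc
  split_ifs
  · linarith [gaussErf_le_one (x / (2 * √s))]
  · exact le_rfl

lemma abs_heatErfc_le_two (x s : ℝ) : |heatErfc x s| ≤ 2 := by
  rw [abs_of_nonneg (heatErfc_nonneg x s)]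
  unfold heatErfc
  split_ifs
  · linarith [neg_one_le_gaussErf (x / (2 * √s))]
  · norm_num

lemma heatErfc_anti (s : ℝ) : Antitone fun x => heatErfc x s := by
  intro x y hxy
  by_cases hs : 0 < s
  · simp only [heatErfc_of_pos hs]
    have := monotone_gaussErf (div_le_div_of_nonneg_right hxy (by positivity : 0 ≤ 2 * √s))
    linarith
  · simp [heatErfc, hs]

lemma heatGauss_nonneg (x s : ℝ) : 0 ≤ heatGauss x s := by unfold heatGauss; positivity

lemma heatGauss_le (x s : ℝ) : heatGauss x s ≤ (√s)⁻¹ := by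
  rcases le_or_gt s 0 with hs | hs
  · rw [heatGauss_of_nonpos hs]; positivity
  · refine mul_le_of_le_one_right (by positivity) (Real.exp_le_one_iff.2 ?_)
    rw [neg_div]
    have : 0 ≤ x ^ 2 / (4 * s) := by positivity
    linarith

lemma hasDerivAt_heatErfc_space (x s : ℝ) :
    HasDerivAt (fun y => heatErfc y s) (-(√Real.pi)⁻¹ * heatGauss x s) x := by
  rcases le_or_gt s 0 with hs | hs
  · simp only [heatErfc_of_nonpos hs, heatGauss_of_nonpos hs, mul_zero]
    exact hasDerivAt_const _ _
  · simp only [heatErfc_of_pos hs]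
    have h := ((hasDerivAt_gaussErf (x / (2 * √s))).comp x
      ((hasDerivAt_id x).div_const (2 * √s))).const_sub 1
    refine h.congr_deriv ?_
    have h1 : √Real.pi ≠ 0 := by positivity
    have h2 : √s ≠ 0 := by positivity
    have h3 : -(x / (2 * √s)) ^ 2 = -x ^ 2 / (4 * s) := by
      rw [div_pow, mul_pow, Real.sq_sqrt hs.le]; ring
    rw [heatGauss, h3]
    field_simp

lemma hasDerivAt_heatGauss_space (x s : ℝ) :
    HasDerivAt (fun y => heatGauss y s) (-(x / (2 * s)) * heatGauss x s) x := by
  have h : HasDerivAt (fun y : ℝ => -y ^ 2 / (4 * s)) (-(2 * x) / (4 * s)) x := by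
    simpa using ((hasDerivAt_pow 2 x).neg).div_const (4 * s)
  refine (h.exp.const_mul (√s)⁻¹).congr_deriv ?_
  rcases eq_or_ne s 0 with rfl | hs
  · simp
  · rw [heatGauss]; field_simp; ring

lemma hasDerivAt_heatErfc_space_deriv (x s : ℝ) :
    HasDerivAt (fun y => -(√Real.pi)⁻¹ * heatGauss y s) (heatPoisson x s) x := by
  refine ((hasDerivAt_heatGauss_space x s).const_mul _).congr_deriv ?_
  rw [heatPoisson]; ring

lemma hasDerivAt_heatGauss_space_deriv (x s : ℝ) :
    HasDerivAt (fun y => -(y / (2 * s)) * heatGauss y s)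
      ((x ^ 2 / (4 * s ^ 2) - 1 / (2 * s)) * heatGauss x s) x := by
  refine ((((hasDerivAt_id x).div_const (2 * s)).neg).mul
    (hasDerivAt_heatGauss_space x s)).congr_deriv ?_
  simp only [Pi.neg_apply, id_eq]
  rcases eq_or_ne s 0 with rfl | hs
  · simp
  · field_simp; ring

lemma hasDerivAt_heatGauss_time (x : ℝ) {s : ℝ} (hs : 0 < s) :
    HasDerivAt (fun r => heatGauss x r) ((x ^ 2 / (4 * s ^ 2) - 1 / (2 * s)) * heatGauss x s) s := by
  have h2 : √s ≠ 0 := by positivity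
  have h1 : HasDerivAt (fun r : ℝ => -x ^ 2 / (4 * r)) (x ^ 2 / (4 * s ^ 2)) s := by
    refine ((hasDerivAt_const s (-x ^ 2)).div ((hasDerivAt_id s).const_mul 4)
      (by simpa using hs.ne')).congr_deriv ?_
    simp only [id_eq]; field_simp; ring
  refine (((Real.hasDerivAt_sqrt hs.ne').inv h2).mul h1.exp).congr_deriv ?_
  simp only [Pi.inv_apply]
  rw [heatGauss, Real.sq_sqrt hs.le]
  field_simp; ring

lemma heatPoisson_nonneg {x : ℝ} (hx : 0 ≤ x) (s : ℝ) : 0 ≤ heatPoisson x s := by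
  rcases le_or_gt s 0 with hs | hs
  · rw [heatPoisson_of_nonpos hs]
  · have := heatGauss_nonneg x s
    unfold heatPoisson; positivity

lemma heatPoisson_le {x : ℝ} (hx : 0 < x) (s : ℝ) : heatPoisson x s ≤ 16 * √s / x ^ 3 := by
  rcases le_or_gt s 0 with hs | hs
  · rw [heatPoisson_of_nonpos hs]; positivity
  · have hu : 0 < x ^ 2 / (4 * s) := by positivity
    have he : Real.exp (-x ^ 2 / (4 * s)) ≤ 2 / (x ^ 2 / (4 * s)) ^ 2 := by
      rw [neg_div, Real.exp_neg, inv_le_comm₀ (Real.exp_pos _) (by positivity), inv_div]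
      linarith [Real.quadratic_le_exp_of_nonneg hu.le]
    have hp : (√Real.pi)⁻¹ ≤ 1 := by
      refine inv_le_one_of_one_le₀ (Real.one_le_sqrt.2 ?_)
      linarith [Real.pi_gt_three]
    have hr : 0 < √s := by positivity
    calc heatPoisson x s
        ≤ 1 * (x / (2 * s) * ((√s)⁻¹ * (2 / (x ^ 2 / (4 * s)) ^ 2))) := by
          unfold heatPoisson heatGauss; gcongr
      _ = 16 * √s / x ^ 3 := by
          have h4 : √s ^ 2 = s := Real.sq_sqrt hs.le
          field_simp
          rw [h4]; ring

lemma continuousAt_heatErfc {p : ℝ × ℝ} (hp : p.2 ≠ 0) :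
    ContinuousAt (fun p : ℝ × ℝ => heatErfc p.1 p.2) p := by
  rcases hp.lt_or_gt with hs | hs
  · refine (continuousAt_const (y := (0 : ℝ))).congr ?_
    filter_upwards [(isOpen_Iio.preimage continuous_snd).mem_nhds hs] with r hr
    exact (heatErfc_of_nonpos (le_of_lt hr) _).symm
  · have h2 : 2 * √p.2 ≠ 0 := by positivity
    have h : ContinuousAt (fun p : ℝ × ℝ => 1 - gaussErf (p.1 / (2 * √p.2))) p := by
      refine continuousAt_const.sub (continuous_gaussErf.continuousAt.comp ?_)
      exact continuousAt_fst.div (continuousAt_const.mul continuousAt_snd.sqrt) h2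
    refine h.congr ?_
    filter_upwards [(isOpen_Ioi.preimage continuous_snd).mem_nhds hs] with r hr
    exact (heatErfc_of_pos hr _).symm

lemma tendsto_heatErfc_zero {x : ℝ} (hx : 0 < x) : Tendsto (heatErfc x) (𝓝 0) (𝓝 0) := by
  have h1 : Tendsto (fun s : ℝ => 2 * √s) (𝓝[>] 0) (𝓝[>] 0) := by
    refine tendsto_nhdsWithin_iff.2 ⟨?_, ?_⟩
    · have : Continuous fun s : ℝ => 2 * √s := by fun_prop
      simpa using (this.tendsto 0).mono_left nhdsWithin_le_nhds
    · filter_upwards [self_mem_nhdsWithin] with s hs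
      have : 0 < √s := Real.sqrt_pos.2 hs
      simpa using this
  have h2 : Tendsto (fun s : ℝ => 1 - gaussErf (x / (2 * √s))) (𝓝[>] 0) (𝓝 0) := by
    have h3 := tendsto_gaussErf_atTop.comp ((tendsto_inv_nhdsGT_zero.comp h1).const_mul_atTop hx)
    simpa [Function.comp_def, div_eq_mul_inv] using h3.const_sub 1
  suffices h : Tendsto (heatErfc x) (𝓝[≤] 0 ⊔ 𝓝[>] 0) (𝓝 0) by rwa [nhdsLE_sup_nhdsGT] at h
  refine tendsto_sup.2 ⟨(tendsto_const_nhds (x := (0 : ℝ))).congr' ?_, h2.congr' ?_⟩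
  · filter_upwards [self_mem_nhdsWithin] with s hs
    exact (heatErfc_of_nonpos hs _).symm
  · filter_upwards [self_mem_nhdsWithin] with s hs
    exact (heatErfc_of_pos hs _).symm

lemma hasDerivAt_heatErfc_time {x : ℝ} (hx : 0 < x) (s : ℝ) :
    HasDerivAt (heatErfc x) (heatPoisson x s) s := by
  refine hasDerivAt_of_hasDerivAt_of_ne' (x := 0) (g := heatPoisson x) ?_ ?_ ?_ s
  · intro s hs
    rcases hs.lt_or_gt with hs | hs
    · rw [heatPoisson_of_nonpos hs.le]
      refine (hasDerivAt_const s (0 : ℝ)).congr_of_eventuallyEq ?_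
      filter_upwards [Iio_mem_nhds hs] with r hr
      exact heatErfc_of_nonpos (le_of_lt hr) _
    · have h2 : √s ≠ 0 := by positivity
      have h1 : √Real.pi ≠ 0 := by positivity
      have h := ((hasDerivAt_gaussErf (x / (2 * √s))).comp s ((hasDerivAt_const s x).div
        ((Real.hasDerivAt_sqrt hs.ne').const_mul 2) (by positivity))).const_sub 1
      refine (h.congr_deriv ?_).congr_of_eventuallyEq ?_
      · have h3 : -(x / (2 * √s)) ^ 2 = -x ^ 2 / (4 * s) := by
          rw [div_pow, mul_pow, Real.sq_sqrt hs.le]; ring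
        have h4 : √s ^ 2 = s := Real.sq_sqrt hs.le
        rw [heatPoisson, heatGauss, h3]
        field_simp
        rw [h4]; ring
      · filter_upwards [Ioi_mem_nhds hs] with r hr
        exact heatErfc_of_pos hr _
  · simpa [ContinuousAt, heatErfc_of_nonpos le_rfl] using tendsto_heatErfc_zero hx
  · have h : Tendsto (fun s => 16 * √s / x ^ 3) (𝓝 0) (𝓝 0) := by
      have : Continuous fun s : ℝ => 16 * √s / x ^ 3 := by fun_prop
      simpa using this.tendsto 0
    simpa [ContinuousAt, heatPoisson_of_nonpos le_rfl] using
      squeeze_zero (heatPoisson_nonneg hx.le) (heatPoisson_le hx) h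

lemma measurable_heatErfc (x : ℝ) : Measurable (heatErfc x) := by
  unfold heatErfc
  refine Measurable.ite measurableSet_Ioi (measurable_const.sub
    (continuous_gaussErf.measurable.comp ?_)) measurable_const
  fun_prop

lemma measurable_heatGauss (x : ℝ) : Measurable (heatGauss x) := by
  unfold heatGauss; fun_prop

lemma measurable_heatPoisson (x : ℝ) : Measurable (heatPoisson x) := by
  have := measurable_heatGauss x
  unfold heatPoisson; fun_prop

/-- `u` satisfies `∂ₜu = ∂ₓₓu` at `(x, t)`, with a left derivative in time. -/
def HeatEqAt (u : ℝ → ℝ → ℝ) (x t : ℝ) : Prop :=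
  ∃ (f' : ℝ → ℝ) (b : ℝ), (∀ᶠ y in 𝓝 x, HasDerivAt (fun ξ => u ξ t) (f' y) y) ∧
    HasDerivAt f' b x ∧ HasDerivWithinAt (fun τ => u x τ) b (Iic t) t

lemma HeatEqAt.sub {u v : ℝ → ℝ → ℝ} {x t : ℝ} (hu : HeatEqAt u x t) (hv : HeatEqAt v x t) :
    HeatEqAt (fun y s => u y s - v y s) x t := by
  obtain ⟨f, a, hf, hfa, ha⟩ := hu
  obtain ⟨g, b, hg, hgb, hb⟩ := hv
  refine ⟨fun y => f y - g y, a - b, ?_, hfa.sub hgb, ha.sub hb⟩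
  filter_upwards [hf, hg] with y h1 h2 using h1.sub h2

/-- The second derivative is nonpositive at a local maximum. -/
lemma IsLocalMax.second_deriv_nonpos {f f' : ℝ → ℝ} {b x : ℝ} (hmax : IsLocalMax f x)
    (hf : ∀ᶠ y in 𝓝 x, HasDerivAt f (f' y) y) (hb : HasDerivAt f' b x) : b ≤ 0 := by
  by_contra! hpos
  have hd : deriv f =ᶠ[𝓝 x] f' := hf.mono fun y hy => hy.deriv
  have hdd : deriv (deriv f) x = b := hd.deriv_eq.trans hb.deriv
  have hmin : IsLocalMin f x := isLocalMin_of_deriv_deriv_pos (by rwa [hdd]) hmax.deriv_eq_zero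
    hf.self_of_nhds.continuousAt
  have hconst : f =ᶠ[𝓝 x] fun _ => f x := by
    filter_upwards [hmax, hmin] with y h1 h2 using le_antisymm h1 h2
  have hzero : deriv (deriv f) x = 0 := by
    rw [hconst.deriv.deriv_eq]; simp
  linarith

/-- A left derivative is nonnegative at a maximum over an interval to the left. -/
lemma HasDerivWithinAt.nonneg_of_forall_le {f : ℝ → ℝ} {b a t : ℝ} (hat : a < t)
    (hf : HasDerivWithinAt f b (Iic t) t) (hmax : ∀ s ∈ Icc a t, f s ≤ f t) : 0 ≤ b := by
  have h := (hasDerivWithinAt_iff_tendsto_slope' self_notMem_Iio).1 (hf.mono Iio_subset_Iic_self)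
  refine ge_of_tendsto h ?_
  filter_upwards [Ioo_mem_nhdsLT hat] with s hs
  rw [slope_def_field]
  exact div_nonneg_of_nonpos (by linarith [hmax s ⟨hs.1.le, hs.2.le⟩]) (by linarith [hs.2])

/-- Weak maximum principle for the heat equation on a rectangle. -/
lemma heat_weak_max_principle {u : ℝ → ℝ → ℝ} {R a t : ℝ}
    (hc : ContinuousOn (fun p : ℝ × ℝ => u p.1 p.2) (Icc 0 R ×ˢ Icc a t))
    (heq : ∀ x ∈ Ioo 0 R, ∀ s ∈ Ioc a t, HeatEqAt u x s)
    (hl : ∀ s ∈ Icc a t, u 0 s ≤ 0) (hr : ∀ s ∈ Icc a t, u R s ≤ 0)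
    (hb : ∀ x ∈ Icc 0 R, u x a ≤ 0) {x : ℝ} (hx : x ∈ Icc 0 R) (hat : a ≤ t) : u x t ≤ 0 := by
  suffices h : ∀ κ > 0, u x t ≤ κ * (t - a) by
    have ht : Tendsto (fun κ : ℝ => κ * (t - a)) (𝓝[>] 0) (𝓝 0) := by
      have : Continuous fun κ : ℝ => κ * (t - a) := by fun_prop
      simpa using (this.tendsto 0).mono_left nhdsWithin_le_nhds
    exact ge_of_tendsto ht (by filter_upwards [self_mem_nhdsWithin] with κ hκ using h κ hκ)
  intro κ hκ
  have hcv : ContinuousOn (fun p : ℝ × ℝ => u p.1 p.2 - κ * (p.2 - a)) (Icc 0 R ×ˢ Icc a t) :=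
    hc.sub (by fun_prop)
  obtain ⟨⟨y, s⟩, ⟨hy, hs⟩, hmax⟩ := (isCompact_Icc.prod isCompact_Icc).exists_isMaxOn
    ⟨(x, t), hx, right_mem_Icc.2 hat⟩ hcv
  simp only at hy hs
  have hmax' : ∀ z ∈ Icc 0 R, ∀ r ∈ Icc a t, u z r - κ * (r - a) ≤ u y s - κ * (s - a) :=
    fun z hz r hr => hmax (a := (z, r)) ⟨hz, hr⟩
  have hxt := hmax' x hx t (right_mem_Icc.2 hat)
  suffices h : u y s - κ * (s - a) ≤ 0 by linarith
  have hsa : 0 ≤ κ * (s - a) := mul_nonneg hκ.le (by linarith [hs.1])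
  rcases hy.1.eq_or_lt with rfl | hy0
  · linarith [hl s hs]
  rcases hy.2.eq_or_lt with rfl | hyR
  · linarith [hr s hs]
  rcases hs.1.eq_or_lt with rfl | hsa'
  · linarith [hb y hy]
  obtain ⟨f', b, hf, hfb, hbt⟩ := heq y ⟨hy0, hyR⟩ s ⟨hsa', hs.2⟩
  exfalso
  have hxx : b ≤ 0 := by
    refine IsLocalMax.second_deriv_nonpos (f := fun ξ => u ξ s) ?_ hf hfb
    filter_upwards [Ioo_mem_nhds hy0 hyR] with z hz
    linarith [hmax' z (Ioo_subset_Icc_self hz) s hs]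
  have htt : 0 ≤ b - κ := by
    refine HasDerivWithinAt.nonneg_of_forall_le (f := fun r => u y r - κ * (r - a)) hsa' ?_ ?_
    · refine (hbt.sub ((((hasDerivAt_id s).sub_const a).const_mul κ).hasDerivWithinAt)).congr_deriv ?_
      ring
    · exact fun r hr => hmax' y hy r ⟨hr.1, hr.2.trans hs.2⟩
  linarith

lemma heatEqAt_const (c x t : ℝ) : HeatEqAt (fun _ _ => c) x t :=
  ⟨fun _ => 0, 0, .of_forall fun _ => hasDerivAt_const _ _, hasDerivAt_const _ _,
    hasDerivWithinAt_const _ _ _⟩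

lemma heatEqAt_heatGauss_shift (c x : ℝ) {a t : ℝ} (ht : 0 < t + a) :
    HeatEqAt (fun y s => c * heatGauss y (s + a)) x t :=
  ⟨_, _, .of_forall fun y => (hasDerivAt_heatGauss_space y (t + a)).const_mul c,
    (hasDerivAt_heatGauss_space_deriv x (t + a)).const_mul c,
    (((hasDerivAt_heatGauss_time x ht).comp_add_const t a).const_mul c).hasDerivWithinAt⟩

lemma heatEqAt_quadratic (c a x t : ℝ) :
    HeatEqAt (fun y s => c * (y ^ 2 + 2 * (s - a))) x t := by
  refine ⟨fun y => c * (2 * y), c * 2, .of_forall fun y => ?_, ?_, ?_⟩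
  · simpa using ((hasDerivAt_pow 2 y).add_const (2 * (t - a))).const_mul c
  · simpa using ((hasDerivAt_id x).const_mul 2).const_mul c
  · simpa using (((((hasDerivAt_id t).sub_const a).const_mul 2).const_add
      (x ^ 2)).const_mul c).hasDerivWithinAt

/-- Maximum principle on the half line for functions bounded above: the boundary values near the
corner `(0, 0)` play no role. -/
lemma heat_halfline_nonpos {w : ℝ → ℝ → ℝ} {T M : ℝ}
    (hM : ∀ x, 0 ≤ x → ∀ t ∈ Ioc 0 T, w x t ≤ M)
    (hc : ContinuousOn (fun p : ℝ × ℝ => w p.1 p.2) (Ici 0 ×ˢ Ioc 0 T))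
    (h0 : ∀ t ∈ Ioc 0 T, w 0 t ≤ 0)
    (heq : ∀ x, 0 < x → ∀ t ∈ Ioc 0 T, HeatEqAt w x t)
    (hinit : ∀ η > 0, ∀ R, ∀ ε > 0, ∀ᶠ t in 𝓝[>] 0, ∀ x ∈ Icc η R, w x t ≤ ε)
    {x t : ℝ} (hx : 0 ≤ x) (ht : t ∈ Ioc 0 T) : w x t ≤ 0 := by
  wlog hM0 : 0 ≤ M generalizing M
  · exact this (fun y hy s hs => (hM y hy s hs).trans (le_of_not_ge hM0)) le_rfl
  set A : ℝ := M * Real.exp (1 / 4) with hA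
  have hA0 : 0 ≤ A := by positivity
  suffices h : ∀ ε > 0, ε * x < 1 →
      w x t ≤ ε + A * ε * (√(t / 2))⁻¹ + M * ε ^ 2 * (x ^ 2 + 2 * t) by
    have hcont : Continuous fun ε : ℝ =>
      ε + A * ε * (√(t / 2))⁻¹ + M * ε ^ 2 * (x ^ 2 + 2 * t) := by fun_prop
    have hlim := (hcont.tendsto 0).mono_left (nhdsWithin_le_nhds (s := Ioi 0))
    simp only [mul_zero, zero_mul, add_zero, ne_eq, OfNat.ofNat_ne_zero, not_false_eq_true,
      zero_pow] at hlim
    refine ge_of_tendsto hlim ?_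
    have hsmall : ∀ᶠ ε in 𝓝[>] (0 : ℝ), ε * x < 1 := by
      have : Continuous fun ε : ℝ => ε * x := by fun_prop
      exact nhdsWithin_le_nhds ((this.tendsto 0).eventually (gt_mem_nhds (by simp)))
    filter_upwards [self_mem_nhdsWithin, hsmall] with ε h1 h2 using h ε h1 h2
  intro ε hε hεx
  have hR : x < ε⁻¹ := by rwa [← one_div, lt_div_iff₀ hε, mul_comm]
  obtain ⟨δ, hδε, hδ0, hδt⟩ := ((hinit ε hε ε⁻¹ ε hε).and
    (Ioo_mem_nhdsGT (half_pos ht.1))).exists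
  have hδt' : δ ≤ t := by linarith [ht.1]
  have hgauss : ∀ y s, 0 ≤ A * ε * heatGauss y (s + (ε ^ 2 - δ)) := fun y s =>
    mul_nonneg (by positivity) (heatGauss_nonneg _ _)
  have hquad : ∀ y s, δ ≤ s → 0 ≤ M * ε ^ 2 * (y ^ 2 + 2 * (s - δ)) := fun y s hs =>
    mul_nonneg (by positivity) (by nlinarith [sq_nonneg y])
  have hsub : Icc δ t ⊆ Ioc 0 T := fun s hs => ⟨hδ0.trans_le hs.1, hs.2.trans ht.2⟩
  have key := heat_weak_max_principle (R := ε⁻¹) (a := δ) (t := t) (x := x)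
    (u := fun y s => w y s - ε - A * ε * heatGauss y (s + (ε ^ 2 - δ))
      - M * ε ^ 2 * (y ^ 2 + 2 * (s - δ))) ?_ ?_ ?_ ?_ ?_ ⟨hx, hR.le⟩ hδt'
  · have h1 : heatGauss x (t + (ε ^ 2 - δ)) ≤ (√(t / 2))⁻¹ := by
      refine (heatGauss_le _ _).trans ?_
      have : 0 < t / 2 := half_pos ht.1
      gcongr
      nlinarith [sq_nonneg ε]
    have h2 := mul_le_mul_of_nonneg_left h1 (by positivity : 0 ≤ A * ε)
    have h3 : M * ε ^ 2 * (x ^ 2 + 2 * (t - δ)) ≤ M * ε ^ 2 * (x ^ 2 + 2 * t) := by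
      gcongr; linarith
    linarith
  · have hpos : ∀ p ∈ Icc 0 ε⁻¹ ×ˢ Icc δ t, 0 < p.2 + (ε ^ 2 - δ) := by
      intro p hp
      have := hp.2.1
      nlinarith [sq_pos_of_pos hε]
    have hg : ContinuousOn (fun p : ℝ × ℝ => heatGauss p.1 (p.2 + (ε ^ 2 - δ)))
        (Icc 0 ε⁻¹ ×ˢ Icc δ t) := by
      unfold heatGauss
      refine ContinuousOn.mul (ContinuousOn.inv₀ (by fun_prop) fun p hp =>
        (Real.sqrt_pos.2 (hpos p hp)).ne') (ContinuousOn.rexp (ContinuousOn.div (by fun_prop)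
        (by fun_prop) fun p hp => ?_))
      have := hpos p hp
      positivity
    have hw := hc.mono (prod_mono (s₁ := Icc 0 ε⁻¹) (fun y hy => hy.1) hsub)
    exact ((hw.sub continuousOn_const).sub (hg.const_mul _)).sub (by fun_prop)
  · intro y hy s hs
    refine (((heq y hy.1 s (hsub (Ioc_subset_Icc_self hs))).sub (heatEqAt_const ε y s)).sub
      (heatEqAt_heatGauss_shift (A * ε) y ?_)).sub (heatEqAt_quadratic (M * ε ^ 2) δ y s)
    nlinarith [sq_pos_of_pos hε, hs.1]
  · intro s hs
    linarith [h0 s (hsub hs), hgauss 0 s, hquad 0 s hs.1]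
  · intro s hs
    have h1 := hM ε⁻¹ (by positivity) s (hsub hs)
    have h2 : M ≤ M * ε ^ 2 * (ε⁻¹ ^ 2 + 2 * (s - δ)) := by
      calc M = M * ε ^ 2 * (ε⁻¹ ^ 2 + 0) := by field_simp; simp
        _ ≤ _ := by gcongr; linarith [hs.1]
    linarith [hgauss ε⁻¹ s]
  · intro y hy
    rcases le_total ε y with hεy | hyε
    · linarith [hδε y ⟨hεy, hy.2⟩, hgauss y δ, hquad y δ le_rfl]
    · have h1 := hM y hy.1 δ (hsub ⟨le_rfl, hδt'⟩)
      have h2 : M ≤ A * ε * heatGauss y (δ + (ε ^ 2 - δ)) := by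
        rw [add_sub_cancel, heatGauss, Real.sqrt_sq hε.le, hA]
        have h3 : (1 : ℝ) ≤ Real.exp (1 / 4) * Real.exp (-y ^ 2 / (4 * ε ^ 2)) := by
          rw [← Real.exp_add, Real.one_le_exp_iff, neg_div, ← sub_eq_add_neg, sub_nonneg,
            div_le_div_iff₀ (by positivity) (by norm_num)]
          nlinarith [hy.1]
        calc M = M * 1 := (mul_one M).symm
          _ ≤ M * (Real.exp (1 / 4) * Real.exp (-y ^ 2 / (4 * ε ^ 2))) := by gcongr
          _ = _ := by field_simp
      linarith [hquad y δ le_rfl]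

/-- Duhamel's formula for the half-line heat equation with zero initial data and boundary data
`c + ∫₀ᵗ g`. -/
noncomputable def heatDuhamel (c T : ℝ) (g : ℝ → ℝ) (x t : ℝ) : ℝ :=
  c * heatErfc x t + ∫ s in Ioc 0 T, g s * heatErfc x (t - s)

lemma integrableOn_inv_sqrt_sub {T : ℝ} (hT : 0 ≤ T) (t : ℝ) :
    IntegrableOn (fun s => (√(t - s))⁻¹) (Ioc 0 T) := by
  have h : IntervalIntegrable (fun u : ℝ => u ^ (-2⁻¹ : ℝ)) volume (t - 0) (t - T) :=
    intervalIntegrable_rpow' (by norm_num)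
  have h2 := (intervalIntegrable_iff_integrableOn_Ioc_of_le hT).1 (by simpa using h.comp_sub_left t)
  refine Integrable.mono h2 (by fun_prop) (.of_forall fun s => ?_)
  rcases le_or_gt (t - s) 0 with hs | hs
  · simp [Real.sqrt_eq_zero_of_nonpos hs]
  · rw [Real.rpow_neg hs.le, Real.sqrt_eq_rpow, one_div]

lemma setIntegral_mul_eq_intervalIntegral {T t : ℝ} (ht : t ∈ Icc 0 T) (g F : ℝ → ℝ)
    (hF : ∀ s ≤ 0, F s = 0) :
    ∫ s in Ioc 0 T, g s * F (t - s) = ∫ s in (0 : ℝ)..t, g s * F (t - s) := by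
  rw [intervalIntegral.integral_of_le ht.1]
  refine setIntegral_eq_of_subset_of_forall_sdiff_eq_zero measurableSet_Ioc
    (Ioc_subset_Ioc_right ht.2) fun s hs => ?_
  have : t < s := by
    by_contra! h
    exact hs.2 ⟨hs.1.1, h⟩
  rw [hF _ (by linarith), mul_zero]

section Duhamel

variable {c T G : ℝ} {g : ℝ → ℝ}

lemma integrableOn_mul_of_bound (hgm : AEStronglyMeasurable g (volume.restrict (Ioc 0 T)))
    (hgb : ∀ s ∈ Ioc 0 T, |g s| ≤ G) {F : ℝ → ℝ} (hF : Measurable F) {K : ℝ}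
    (hK : ∀ s, |F s| ≤ K) : IntegrableOn (fun s => g s * F s) (Ioc 0 T) := by
  have hK0 : 0 ≤ K := (abs_nonneg _).trans (hK 0)
  refine Integrable.of_bound (hgm.mul hF.aestronglyMeasurable) (G * K) ?_
  filter_upwards [ae_restrict_mem measurableSet_Ioc] with s hs
  rw [norm_mul]
  exact mul_le_mul (hgb s hs) (hK s) (abs_nonneg _) ((abs_nonneg _).trans (hgb s hs))

lemma hasDerivAt_heatDuhamel_space (hT : 0 ≤ T)
    (hgm : AEStronglyMeasurable g (volume.restrict (Ioc 0 T)))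
    (hgb : ∀ s ∈ Ioc 0 T, |g s| ≤ G) (x t : ℝ) :
    HasDerivAt (fun y => heatDuhamel c T g y t) (c * (-(√Real.pi)⁻¹ * heatGauss x t) +
      ∫ s in Ioc 0 T, g s * (-(√Real.pi)⁻¹ * heatGauss x (t - s))) x := by
  refine ((hasDerivAt_heatErfc_space x t).const_mul c).add ?_
  have hmE : ∀ y, Measurable fun s => heatErfc y (t - s) := fun y =>
    (measurable_heatErfc y).comp (by fun_prop)
  have hmG : Measurable fun s => heatGauss x (t - s) := (measurable_heatGauss x).comp (by fun_prop)
  refine (_root_.hasDerivAt_integral_of_dominated_loc_of_deriv_le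
    (F := fun y s => g s * heatErfc y (t - s))
    (F' := fun y s => g s * (-(√Real.pi)⁻¹ * heatGauss y (t - s)))
    (bound := fun s => G * ((√Real.pi)⁻¹ * (√(t - s))⁻¹)) univ_mem ?_ ?_ ?_ ?_ ?_ ?_).2
  · exact .of_forall fun y => hgm.mul (hmE y).aestronglyMeasurable
  · exact integrableOn_mul_of_bound hgm hgb (hmE x) fun s => abs_heatErfc_le_two x (t - s)
  · exact hgm.mul (hmG.const_mul _).aestronglyMeasurable
  · filter_upwards [ae_restrict_mem measurableSet_Ioc] with s hs y _
    rw [norm_mul, norm_mul, norm_neg, Real.norm_of_nonneg (heatGauss_nonneg _ _),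
      Real.norm_of_nonneg (by positivity : 0 ≤ (√Real.pi)⁻¹)]
    have := heatGauss_nonneg y (t - s)
    have hG : 0 ≤ G := (abs_nonneg _).trans (hgb s hs)
    exact mul_le_mul (hgb s hs) (by gcongr; exact heatGauss_le _ _) (by positivity) hG
  · exact ((integrableOn_inv_sqrt_sub hT t).const_mul _).const_mul _
  · exact .of_forall fun s y _ => (hasDerivAt_heatErfc_space y (t - s)).const_mul _

lemma abs_heatPoisson_le {a x : ℝ} (ha : 0 < a) (hax : a ≤ x) {s b : ℝ} (hs : s ≤ b) :
    |heatPoisson x s| ≤ 16 * √b / a ^ 3 := by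
  have hx := ha.trans_le hax
  rw [abs_of_nonneg (heatPoisson_nonneg hx.le s)]
  refine (heatPoisson_le hx s).trans ?_
  gcongr

lemma norm_mul_heatPoisson_le (hgb : ∀ s ∈ Ioc 0 T, |g s| ≤ G) {a x : ℝ} (ha : 0 < a)
    (hax : a ≤ x) {t b : ℝ} (htb : t ≤ b) {s : ℝ} (hs : s ∈ Ioc 0 T) :
    ‖g s * heatPoisson x (t - s)‖ ≤ G * (16 * √b / a ^ 3) := by
  rw [norm_mul]
  exact mul_le_mul (hgb s hs) (abs_heatPoisson_le ha hax (by linarith [hs.1])) (abs_nonneg _)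
    ((abs_nonneg _).trans (hgb s hs))

lemma hasDerivAt_heatDuhamel_space_deriv (hT : 0 ≤ T)
    (hgm : AEStronglyMeasurable g (volume.restrict (Ioc 0 T)))
    (hgb : ∀ s ∈ Ioc 0 T, |g s| ≤ G) {x : ℝ} (hx : 0 < x) (t : ℝ) :
    HasDerivAt (fun y => c * (-(√Real.pi)⁻¹ * heatGauss y t) +
      ∫ s in Ioc 0 T, g s * (-(√Real.pi)⁻¹ * heatGauss y (t - s)))
      (c * heatPoisson x t + ∫ s in Ioc 0 T, g s * heatPoisson x (t - s)) x := by
  refine ((hasDerivAt_heatErfc_space_deriv x t).const_mul c).add ?_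
  have hmG : ∀ y, Measurable fun s => heatGauss y (t - s) := fun y =>
    (measurable_heatGauss y).comp (by fun_prop)
  have hmP : Measurable fun s => heatPoisson x (t - s) :=
    (measurable_heatPoisson x).comp (by fun_prop)
  refine (_root_.hasDerivAt_integral_of_dominated_loc_of_deriv_le
    (F := fun y s => g s * (-(√Real.pi)⁻¹ * heatGauss y (t - s)))
    (F' := fun y s => g s * heatPoisson y (t - s))
    (bound := fun _ => G * (16 * √t / (x / 2) ^ 3)) (Ioi_mem_nhds (half_lt_self hx))
    ?_ ?_ ?_ ?_ ?_ ?_).2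
  · exact .of_forall fun y => hgm.mul ((hmG y).const_mul _).aestronglyMeasurable
  · refine Integrable.bdd_mul (c := G) (((integrableOn_inv_sqrt_sub hT t).mono'
      (hmG x).aestronglyMeasurable (.of_forall fun s => ?_)).const_mul _) hgm ?_
    · rw [Real.norm_of_nonneg (heatGauss_nonneg _ _)]
      exact heatGauss_le _ _
    · filter_upwards [ae_restrict_mem measurableSet_Ioc] with s hs using hgb s hs
  · exact hgm.mul hmP.aestronglyMeasurable
  · filter_upwards [ae_restrict_mem measurableSet_Ioc] with s hs y hy
    exact norm_mul_heatPoisson_le hgb (half_pos hx) (le_of_lt hy) le_rfl hs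
  · exact integrable_const _
  · exact .of_forall fun s y _ => (hasDerivAt_heatErfc_space_deriv y (t - s)).const_mul _

lemma hasDerivAt_heatDuhamel_time (hgm : AEStronglyMeasurable g (volume.restrict (Ioc 0 T)))
    (hgb : ∀ s ∈ Ioc 0 T, |g s| ≤ G) {x : ℝ} (hx : 0 < x) (t : ℝ) :
    HasDerivAt (fun τ => heatDuhamel c T g x τ)
      (c * heatPoisson x t + ∫ s in Ioc 0 T, g s * heatPoisson x (t - s)) t := by
  refine ((hasDerivAt_heatErfc_time hx t).const_mul c).add ?_
  have hmE : ∀ τ, Measurable fun s => heatErfc x (τ - s) := fun τ =>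
    (measurable_heatErfc x).comp (by fun_prop)
  have hmP : Measurable fun s => heatPoisson x (t - s) :=
    (measurable_heatPoisson x).comp (by fun_prop)
  refine (_root_.hasDerivAt_integral_of_dominated_loc_of_deriv_le
    (F := fun τ s => g s * heatErfc x (τ - s))
    (F' := fun τ s => g s * heatPoisson x (τ - s))
    (bound := fun _ => G * (16 * √(t + 1) / x ^ 3)) (Iio_mem_nhds (lt_add_one t))
    ?_ ?_ ?_ ?_ ?_ ?_).2
  · exact .of_forall fun τ => hgm.mul (hmE τ).aestronglyMeasurable
  · exact integrableOn_mul_of_bound hgm hgb (hmE t) fun s => abs_heatErfc_le_two x (t - s)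
  · exact hgm.mul hmP.aestronglyMeasurable
  · filter_upwards [ae_restrict_mem measurableSet_Ioc] with s hs τ hτ
    exact norm_mul_heatPoisson_le hgb hx le_rfl (le_of_lt hτ) hs
  · exact integrable_const _
  · exact .of_forall fun s τ _ =>
      ((hasDerivAt_heatErfc_time hx (τ - s)).comp_sub_const τ s).const_mul _

lemma heatEqAt_heatDuhamel (hT : 0 ≤ T) (hgm : AEStronglyMeasurable g (volume.restrict (Ioc 0 T)))
    (hgb : ∀ s ∈ Ioc 0 T, |g s| ≤ G) {x : ℝ} (hx : 0 < x) (t : ℝ) :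
    HeatEqAt (heatDuhamel c T g) x t :=
  ⟨_, _, .of_forall fun y => hasDerivAt_heatDuhamel_space hT hgm hgb y t,
    hasDerivAt_heatDuhamel_space_deriv hT hgm hgb hx t,
    (hasDerivAt_heatDuhamel_time hgm hgb hx t).hasDerivWithinAt⟩

lemma continuousAt_heatDuhamel (hgm : AEStronglyMeasurable g (volume.restrict (Ioc 0 T)))
    (hgb : ∀ s ∈ Ioc 0 T, |g s| ≤ G) {p : ℝ × ℝ} (hp : p.2 ≠ 0) :
    ContinuousAt (fun p : ℝ × ℝ => heatDuhamel c T g p.1 p.2) p := by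
  refine ((continuousAt_heatErfc hp).const_mul c).add ?_
  refine continuousAt_of_dominated (bound := fun _ => G * 2) ?_ ?_ (integrable_const _) ?_
  · exact .of_forall fun r => hgm.mul
      ((measurable_heatErfc r.1).comp (by fun_prop : Measurable fun s => r.2 - s)).aestronglyMeasurable
  · refine .of_forall fun r => ?_
    filter_upwards [ae_restrict_mem measurableSet_Ioc] with s hs
    rw [norm_mul]
    exact mul_le_mul (hgb s hs) (abs_heatErfc_le_two _ _) (abs_nonneg _)
      ((abs_nonneg _).trans (hgb s hs))
  · have hne : ∀ᵐ s ∂(volume.restrict (Ioc 0 T)), s ≠ p.2 :=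
      ae_restrict_of_ae (Measure.ae_ne volume p.2)
    filter_upwards [hne] with s hs
    refine ContinuousAt.const_mul ?_ (g s)
    exact ContinuousAt.comp (f := fun r : ℝ × ℝ => (r.1, r.2 - s))
      (continuousAt_heatErfc (p := (p.1, p.2 - s)) (sub_ne_zero.2 hs.symm)) (by fun_prop)

lemma abs_heatDuhamel_le (hgb : ∀ s ∈ Ioc 0 T, |g s| ≤ G) (x : ℝ) {t : ℝ} (ht : t ∈ Icc 0 T) :
    |heatDuhamel c T g x t| ≤ |c| * heatErfc x t + G * 2 * t := by
  rw [heatDuhamel, setIntegral_mul_eq_intervalIntegral ht g _ fun s hs => heatErfc_of_nonpos hs x]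
  refine (abs_add_le _ _).trans (add_le_add ?_ ?_)
  · rw [abs_mul, abs_of_nonneg (heatErfc_nonneg x t)]
  · have h : ∀ s ∈ uIoc 0 t, ‖g s * heatErfc x (t - s)‖ ≤ G * 2 := by
      intro s hs
      rw [uIoc_of_le ht.1] at hs
      have hs' : s ∈ Ioc 0 T := ⟨hs.1, hs.2.trans ht.2⟩
      rw [norm_mul]
      exact mul_le_mul (hgb s hs') (abs_heatErfc_le_two _ _) (abs_nonneg _)
        ((abs_nonneg _).trans (hgb s hs'))
    simpa [abs_of_nonneg ht.1] using intervalIntegral.norm_integral_le_of_norm_le_const h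

lemma heatDuhamel_zero {t : ℝ} (ht : t ∈ Ioc 0 T) :
    heatDuhamel c T g 0 t = c + ∫ s in (0 : ℝ)..t, g s := by
  rw [heatDuhamel, setIntegral_mul_eq_intervalIntegral (Ioc_subset_Icc_self ht) g _
    fun s hs => heatErfc_of_nonpos hs 0, heatErfc_of_pos ht.1, zero_div, gaussErf_zero, sub_zero,
    mul_one]
  congr 1
  refine intervalIntegral.integral_congr_ae ?_
  filter_upwards [Measure.ae_ne volume t] with s hst hs
  rw [uIoc_of_le ht.1.le] at hs
  rw [heatErfc_of_pos (sub_pos.2 (lt_of_le_of_ne hs.2 hst)), zero_div, gaussErf_zero, sub_zero,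
    mul_one]

lemma eventually_abs_heatDuhamel_le (hT : 0 < T) (hgb : ∀ s ∈ Ioc 0 T, |g s| ≤ G) {η ε : ℝ}
    (hη : 0 < η) (hε : 0 < ε) : ∀ᶠ t in 𝓝[>] 0, ∀ x, η ≤ x → |heatDuhamel c T g x t| ≤ ε := by
  have h1 : Tendsto (fun t => |c| * heatErfc η t + G * 2 * t) (𝓝[>] 0) (𝓝 0) := by
    have h := ((tendsto_heatErfc_zero hη).const_mul |c|).add
      ((tendsto_id (x := 𝓝 (0 : ℝ))).const_mul (G * 2))
    simpa using h.mono_left nhdsWithin_le_nhds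
  filter_upwards [h1.eventually (gt_mem_nhds hε), Ioc_mem_nhdsGT hT] with t ht htT x hx
  refine (abs_heatDuhamel_le hgb x (Ioc_subset_Icc_self htT)).trans (le_trans ?_ ht.le)
  have := heatErfc_anti t hx
  gcongr

end Duhamel

/-- A continuous function that vanishes initially is small at small times, uniformly
away from the boundary and from infinity. -/
lemma eventually_abs_le_of_initial_zero {T : ℝ} (hT : 0 < T) {q : ℝ → ℝ → ℝ}
    (hcont : ContinuousOn (fun p : ℝ × ℝ => q p.1 p.2) (Ioi 0 ×ˢ Icc 0 T))
    (hinit : ∀ x > (0 : ℝ), q x 0 = 0) {η : ℝ} (hη : 0 < η) (R : ℝ) {ε : ℝ} (hε : 0 < ε) :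
    ∀ᶠ t in 𝓝[>] 0, ∀ x ∈ Icc η R, |q x t| ≤ ε := by
  have hu := (isCompact_Icc.prod isCompact_Icc).uniformContinuousOn_of_continuous
    (hcont.mono (prod_mono (s₁ := Icc η R) (fun y hy => hη.trans_le hy.1) subset_rfl))
  obtain ⟨δ, hδ, h⟩ := Metric.uniformContinuousOn_iff.1 hu ε hε
  filter_upwards [Ioo_mem_nhdsGT hδ, Ioc_mem_nhdsGT hT] with t h1 h2 x hx
  have := h (x, t) ⟨hx, h2.1.le, h2.2⟩ (x, 0) ⟨hx, le_rfl, hT.le⟩ (by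
    simpa [Prod.dist_eq, abs_of_pos h1.1] using ⟨hδ, h1.2⟩)
  simp only [hinit x (hη.trans_le hx.1), dist_zero_right, Real.norm_eq_abs] at this
  exact this.le

lemma heatEqAt_of_contDiffOn {T : ℝ} {q : ℝ → ℝ → ℝ}
    (hsmooth : ContDiffOn ℝ (⊤ : ℕ∞) (fun p : ℝ × ℝ => q p.1 p.2) (Ioi 0 ×ˢ Ioc 0 T))
    {x t : ℝ} (hx : 0 < x) (ht : t ∈ Ioc 0 T)
    (hheat : derivWithin (fun τ => q x τ) (Ioc 0 T) t = deriv (deriv (fun ξ => q ξ t)) x) :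
    HeatEqAt q x t := by
  have hs : ContDiffOn ℝ 2 (fun ξ => q ξ t) (Ioi 0) :=
    (hsmooth.of_le (WithTop.coe_le_coe.2 (le_top : (2 : ℕ∞) ≤ ⊤))).comp (f := fun ξ : ℝ => (ξ, t))
      (by fun_prop) fun ξ hξ => ⟨hξ, ht⟩
  have hτ : DifferentiableOn ℝ (fun τ => q x τ) (Ioc 0 T) :=
    (hsmooth.differentiableOn (by simp)).comp (f := fun τ : ℝ => (x, τ))
      (by fun_prop) fun τ hτ => ⟨hx, hτ⟩
  have hs' : ContDiffOn ℝ 1 (deriv fun ξ => q ξ t) (Ioi 0) :=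
    hs.deriv_of_isOpen isOpen_Ioi (by norm_num)
  refine ⟨deriv fun ξ => q ξ t, deriv (deriv fun ξ => q ξ t) x, ?_, ?_, ?_⟩
  · filter_upwards [Ioi_mem_nhds hx] with y hy
    exact ((hs.differentiableOn (by simp)).differentiableAt (Ioi_mem_nhds hy)).hasDerivAt
  · exact ((hs'.differentiableOn (by simp)).differentiableAt (Ioi_mem_nhds hx)).hasDerivAt
  · rw [← hheat]
    refine ((hτ t ht).hasDerivWithinAt.mono (Ioc_subset_Ioc_right ht.2)).mono_of_mem_nhdsWithin ?_
    exact Ioc_mem_nhdsLE ht.1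

/-- Dirichlet-to-Neumann relation for the heat equation on the half line with zero initial
data: if `q` is a bounded solution of `∂ₜq = ∂ₓₓq` on `(0,∞) × (0,T]` with `q(x,0) = 0` and
Dirichlet boundary value `q(0,t) = h(t)` for a `C¹` function `h`, then the one-sided spatial
derivative at `x = 0` exists and equals `-(1/√π)(h(0)/√t + ∫₀ᵗ h'(s)/√(t-s) ds)`. -/
theorem heat_halfline_dirichlet_to_neumann (T : ℝ) (hT : 0 < T) (h : ℝ → ℝ)
    (hh : ContDiffOn ℝ 1 h (Set.Icc 0 T))
    (q : ℝ → ℝ → ℝ)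
    (hbdd : ∃ C, ∀ x ∈ Set.Ici (0 : ℝ), ∀ t ∈ Set.Icc (0 : ℝ) T, |q x t| ≤ C)
    (hcont : ContinuousOn (fun p : ℝ × ℝ => q p.1 p.2)
      ((Set.Ioi 0 ×ˢ Set.Icc 0 T) ∪ ({0} ×ˢ Set.Ioc 0 T)))
    (hsmooth : ContDiffOn ℝ (⊤ : ℕ∞) (fun p : ℝ × ℝ => q p.1 p.2) (Set.Ioi 0 ×ˢ Set.Ioc 0 T))
    (hheat : ∀ x ∈ Set.Ioi (0 : ℝ), ∀ t ∈ Set.Ioc (0 : ℝ) T,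
      derivWithin (fun τ => q x τ) (Set.Ioc 0 T) t = deriv (deriv (fun ξ => q ξ t)) x)
    (hinit : ∀ x > (0 : ℝ), q x 0 = 0)
    (hdir : ∀ t ∈ Set.Ioc (0 : ℝ) T, q 0 t = h t) :
    ∀ t ∈ Set.Ioc (0 : ℝ) T,
      HasDerivWithinAt (fun x => q x t)
        (-(1 / Real.sqrt Real.pi) * (h 0 / Real.sqrt t
          + ∫ s in (0 : ℝ)..t, derivWithin h (Set.Icc 0 T) s / Real.sqrt (t - s)))
        (Set.Ici 0) 0 := by
  set g := derivWithin h (Icc 0 T) with hg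
  have hgc : ContinuousOn g (Icc 0 T) :=
    hh.continuousOn_derivWithin (uniqueDiffOn_Icc hT) le_rfl
  obtain ⟨G, hG⟩ := isCompact_Icc.exists_bound_of_continuousOn hgc
  have hgb : ∀ s ∈ Ioc 0 T, |g s| ≤ G := fun s hs => hG s (Ioc_subset_Icc_self hs)
  have hgm : AEStronglyMeasurable g (volume.restrict (Ioc 0 T)) :=
    (hgc.mono Ioc_subset_Icc_self).aestronglyMeasurable measurableSet_Ioc
  obtain ⟨C, hC⟩ := hbdd
  have hG0 : 0 ≤ G := (abs_nonneg _).trans (hgb T (right_mem_Ioc.2 hT))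
  set Q := heatDuhamel (h 0) T g with hQ
  have hQb : ∀ x, ∀ t ∈ Ioc 0 T, |Q x t| ≤ |h 0| * 2 + G * 2 * T := by
    intro x t ht
    refine (abs_heatDuhamel_le hgb x (Ioc_subset_Icc_self ht)).trans ?_
    have := (le_abs_self _).trans (abs_heatErfc_le_two x t)
    have := ht.2
    gcongr
  have hQ0 : ∀ t ∈ Ioc 0 T, Q 0 t = h t := by
    intro t ht
    have hsub : Icc 0 t ⊆ Icc 0 T := Icc_subset_Icc_right ht.2
    have hftc : ∫ s in (0 : ℝ)..t, g s = h t - h 0 := by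
      refine intervalIntegral.integral_eq_sub_of_hasDerivAt_of_le ht.1.le
        (hh.continuousOn.mono hsub) (fun s hs => ?_)
        ((hgc.mono hsub).intervalIntegrable_of_Icc ht.1.le)
      have hs' : s ∈ Ioo 0 T := ⟨hs.1, hs.2.trans_le ht.2⟩
      exact ((hh.differentiableOn one_ne_zero s (Ioo_subset_Icc_self hs')).hasDerivWithinAt).hasDerivAt
        (Icc_mem_nhds hs'.1 hs'.2)
    rw [hQ, heatDuhamel_zero ht, hftc, add_sub_cancel]
  have hqc : ContinuousOn (fun p : ℝ × ℝ => q p.1 p.2) (Ici 0 ×ˢ Ioc 0 T) := by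
    refine hcont.mono fun p hp => ?_
    rcases (show 0 ≤ p.1 from hp.1).eq_or_lt with h0 | h0
    · exact Or.inr ⟨h0.symm, hp.2⟩
    · exact Or.inl ⟨h0, Ioc_subset_Icc_self hp.2⟩
  have hQc : ContinuousOn (fun p : ℝ × ℝ => Q p.1 p.2) (Ici 0 ×ˢ Ioc 0 T) := fun p hp =>
    (continuousAt_heatDuhamel hgm hgb hp.2.1.ne').continuousWithinAt
  have hqe : ∀ x, 0 < x → ∀ t ∈ Ioc 0 T, HeatEqAt q x t := fun x hx t ht =>
    heatEqAt_of_contDiffOn hsmooth hx ht (hheat x hx t ht)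
  have hQe : ∀ x, 0 < x → ∀ t ∈ Ioc 0 T, HeatEqAt Q x t := fun x hx t _ =>
    heatEqAt_heatDuhamel hT.le hgm hgb hx t
  have hsmall : ∀ η > 0, ∀ R, ∀ ε > 0, ∀ᶠ t in 𝓝[>] (0 : ℝ), ∀ x ∈ Icc η R,
      |q x t - Q x t| ≤ ε := by
    intro η hη R ε hε
    filter_upwards [eventually_abs_le_of_initial_zero hT (hcont.mono subset_union_left) hinit hη R
      (half_pos hε), eventually_abs_heatDuhamel_le (c := h 0) hT hgb hη (half_pos hε)]
      with t h1 h2 x hx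
    linarith [abs_sub (q x t) (Q x t), h1 x hx, h2 x hx.1]
  have hbound : ∀ x, 0 ≤ x → ∀ t ∈ Ioc 0 T,
      |q x t - Q x t| ≤ C + (|h 0| * 2 + G * 2 * T) := fun x hx t ht =>
    (abs_sub _ _).trans (add_le_add (hC x hx t (Ioc_subset_Icc_self ht)) (hQb x t ht))
  intro t ht
  have heq : ∀ x, 0 ≤ x → q x t = Q x t := by
    intro x hx
    have h1 := heat_halfline_nonpos (w := fun y s => q y s - Q y s)
      (fun y hy s hs => (le_abs_self _).trans (hbound y hy s hs)) (hqc.sub hQc)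
      (fun s hs => by rw [hdir s hs, hQ0 s hs, sub_self])
      (fun y hy s hs => (hqe y hy s hs).sub (hQe y hy s hs))
      (fun η hη R ε hε => (hsmall η hη R ε hε).mono fun s hs y hy =>
        (le_abs_self _).trans (hs y hy)) hx ht
    have h2 := heat_halfline_nonpos (w := fun y s => Q y s - q y s)
      (fun y hy s hs => (le_abs_self _).trans (by rw [abs_sub_comm]; exact hbound y hy s hs))
      (hQc.sub hqc) (fun s hs => by rw [hdir s hs, hQ0 s hs, sub_self])
      (fun y hy s hs => (hQe y hy s hs).sub (hqe y hy s hs))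
      (fun η hη R ε hε => (hsmall η hη R ε hε).mono fun s hs y hy =>
        (le_abs_self _).trans (by rw [abs_sub_comm]; exact hs y hy)) hx ht
    linarith
  have hder := (hasDerivAt_heatDuhamel_space (c := h 0) hT.le hgm hgb 0 t).hasDerivWithinAt
    (s := Ici 0)
  refine (hder.congr heq (heq 0 le_rfl)).congr_deriv ?_
  rw [setIntegral_mul_eq_intervalIntegral (Ioc_subset_Icc_self ht) g
    (fun s => -(√Real.pi)⁻¹ * heatGauss 0 s) fun s hs => by rw [heatGauss_of_nonpos hs, mul_zero],
    mul_add, ← intervalIntegral.integral_const_mul]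
  simp only [heatGauss, ne_eq, OfNat.ofNat_ne_zero, not_false_eq_true, zero_pow, neg_zero, zero_div,
    Real.exp_zero, mul_one, one_div]
  congr 1
  · ring
  · congr 1
    ext s
    ring
end
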